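/- Let k, m ∈ ℕ and let α ∈ (k−1, k) be a non-integer real with α + m > 1/2. There exists a constant C > 0, depending only on α and m, such that for every a ∈ ℝ, every h with 0 < h < 2, every integer p with α + m < p + 1, and every u ∈ 𝒰^{α,m}_{a+}((a, a+h)), the Gauss–Radau projection π_p^− u on I = (a, a+h) satisfies ‖u − π_p^− u‖_{L²(a,a+h)} ≤ C · h^{α+1/2} · p^{−min{2α+1, α+m−1/2}} · U^{α,m}_{a+}(u;(a,a+h)). -/

import Mathlib

open MeasureTheory Set Filter

/-- The left Caputo fractional derivative of order `α ∈ (k−1,k)` based at `a`. -/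
noncomputable def caputoL (k : ℕ) (α a : ℝ) (u : ℝ → ℝ) (x : ℝ) : ℝ :=
  (1 / Real.Gamma ((k : ℝ) - α)) *
    ∫ y in a..x, (x - y) ^ ((k : ℝ) - α - 1) * iteratedDeriv k u y

/-- Membership `u ∈ 𝒰^{α,m}_{a+}((a,b))`, with `L i` the right-hand limits
`D^i(^C D^α_{a+} u)(a+)` for `i < m`. -/
def MemULOn (k m : ℕ) (α a b : ℝ) (u : ℝ → ℝ) (L : ℕ → ℝ) : Prop :=
  ContinuousOn u (Icc a b) ∧
  (∀ i < k, ∀ x ∈ Ioo a b,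
      HasDerivAt (iteratedDeriv i u) (iteratedDeriv (i + 1) u x) x) ∧
  (∀ i ≤ k, IntervalIntegrable (iteratedDeriv i u) volume a b) ∧
  (∀ i < m, ∀ x ∈ Ioo a b,
      HasDerivAt (iteratedDeriv i (caputoL k α a u))
        (iteratedDeriv (i + 1) (caputoL k α a u) x) x) ∧
  (∀ i ≤ m, IntervalIntegrable (iteratedDeriv i (caputoL k α a u)) volume a b) ∧
  (∀ i < m, Tendsto (iteratedDeriv i (caputoL k α a u))
      (nhdsWithin a (Ioi a)) (nhds (L i)))

/-- The semi-norm `U^{α,m}_{a+}(u;(a,b))`. -/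
noncomputable def UsemiLOn (k m : ℕ) (α a b : ℝ) (u : ℝ → ℝ) (L : ℕ → ℝ) : ℝ :=
  (∫ x in a..b, |iteratedDeriv m (caputoL k α a u) x|) +
    ∑ i ∈ Finset.range m, |L i|

namespace FracApprox

open Polynomial in
/-- The shifted Legendre polynomial with real coefficients, normalized by `leg n 0 = 1`. -/
noncomputable def leg (n : ℕ) : ℝ[X] := (shiftedLegendre n).map (Int.castRingHom ℝ)

lemma coeff_leg (n k : ℕ) :
    (leg n).coeff k = (-1) ^ k * n.choose k * (n + k).choose n := by
  simp [leg, Polynomial.coeff_shiftedLegendre]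

lemma natDegree_leg (n : ℕ) : (leg n).natDegree = n := by
  rw [leg, Polynomial.natDegree_map_eq_of_injective (Int.castRingHom ℝ).injective_int,
    Polynomial.natDegree_shiftedLegendre]

lemma leg_zero : leg 0 = 1 := by
  ext k
  rw [coeff_leg, Polynomial.coeff_one]
  cases k <;> simp

lemma leg_eval_zero (n : ℕ) : (leg n).eval 0 = 1 := by
  rw [← Polynomial.coeff_zero_eq_eval_zero, coeff_leg]
  simp

lemma leg_eval_symm (n : ℕ) (x : ℝ) :
    (leg n).eval x = (-1) ^ n * (leg n).eval (1 - x) := by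
  have := Polynomial.shiftedLegendre_eval_symm n x
  simpa [leg, Polynomial.aeval_def, Polynomial.eval_map] using this

lemma leg_eval_one (n : ℕ) : (leg n).eval 1 = (-1) ^ n := by
  rw [leg_eval_symm]; simp [leg_eval_zero]

open Polynomial in
lemma X_mul_derivative_leg (n : ℕ) :
    X * (derivative (leg n) + derivative (leg (n + 1))) =
      C ((n : ℝ) + 1) * (leg (n + 1) - leg n) := by
  ext k
  rw [coeff_C_mul, coeff_sub]
  cases k with
  | zero => simp [coeff_leg]
  | succ k =>
    rw [coeff_X_mul, coeff_add, coeff_derivative, coeff_derivative, coeff_leg, coeff_leg]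
    have h1 : (n.choose (k + 1) : ℝ) * (n + 1) = (n + 1).choose (k + 1) * (n - k) := by
      rcases le_or_gt k n with h | h
      · have := Nat.choose_mul_succ_eq n (k + 1)
        rw [show n + 1 - (k + 1) = n - k by lia] at this
        have h2 : ((n - k : ℕ) : ℝ) = n - k := by push_cast [h]; ring
        rw [← h2]; exact_mod_cast this
      · rw [Nat.choose_eq_zero_of_lt (by lia), Nat.choose_eq_zero_of_lt (by lia)]; simp
    have h2 : ((n + (k + 1) : ℕ) + 1 : ℝ) * ((n + (k + 1)).choose n) =
        ((n + 1 + (k + 1)).choose (n + 1)) * (n + 1) := by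
      have := Nat.add_one_mul_choose_eq (n + (k + 1)) n
      rw [show n + (k + 1) + 1 = n + 1 + (k + 1) by lia] at this
      have h3 : (((n + 1 + (k + 1) : ℕ)) : ℝ) * ((n + (k + 1)).choose n : ℝ) =
        ((n + 1 + (k + 1)).choose (n + 1)) * (n + 1) := by exact_mod_cast this
      rw [← h3]; push_cast; ring
    have hn : (n : ℝ) + 1 ≠ 0 := by positivity
    apply mul_left_cancel₀ hn
    push_cast at h2 ⊢
    linear_combination (-1 : ℝ) ^ (k + 1) * ((n + (k + 1)).choose n) * (n + 1 + (k + 1)) * h1 +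
      (-1 : ℝ) ^ (k + 1) * ((n + 1).choose (k + 1)) * (n - k) * h2

/-- The derivative of `leg n` evaluated at `x`. -/
noncomputable def dleg (n : ℕ) (x : ℝ) : ℝ := (Polynomial.derivative (leg n)).eval x

lemma hasDerivAt_leg (n : ℕ) (x : ℝ) : HasDerivAt (fun y => (leg n).eval y) (dleg n x) x :=
  (leg n).hasDerivAt x

lemma continuous_leg (n : ℕ) : Continuous fun y => (leg n).eval y := (leg n).continuous

lemma continuous_dleg (n : ℕ) : Continuous (dleg n) := Polynomial.continuous _

lemma mul_dleg_add (n : ℕ) (x : ℝ) :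
    x * (dleg n x + dleg (n + 1) x) = (n + 1) * ((leg (n + 1)).eval x - (leg n).eval x) := by
  simpa [dleg] using congrArg (Polynomial.eval x) (X_mul_derivative_leg n)

lemma dleg_symm (n : ℕ) (x : ℝ) : dleg n x = -((-1) ^ n * dleg n (1 - x)) := by
  have h1 := hasDerivAt_leg n x
  have h2 : HasDerivAt (fun y => (-1) ^ n * (leg n).eval (1 - y))
      ((-1) ^ n * (dleg n (1 - x) * -1)) x :=
    ((hasDerivAt_leg n (1 - x)).comp x ((hasDerivAt_id x).const_sub 1)).const_mul _
  have h3 : (fun y => (leg n).eval y) = fun y => (-1) ^ n * (leg n).eval (1 - y) :=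
    funext (leg_eval_symm n)
  rw [h3] at h1
  rw [h1.unique h2]; ring

lemma sub_one_mul_dleg_sub (n : ℕ) (x : ℝ) :
    (x - 1) * (dleg (n + 1) x - dleg n x) =
      (n + 1) * ((leg (n + 1)).eval x + (leg n).eval x) := by
  have h := mul_dleg_add n (1 - x)
  rw [leg_eval_symm n x, leg_eval_symm (n + 1) x, dleg_symm n x, dleg_symm (n + 1) x]
  rw [pow_succ]
  linear_combination (-1) ^ (n + 1) * h

lemma dleg_succ (n : ℕ) (x : ℝ) :
    dleg (n + 1) x = (1 - 2 * x) * dleg n x - 2 * (n + 1) * (leg n).eval x := by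
  linear_combination mul_dleg_add n x - sub_one_mul_dleg_sub n x

lemma dleg_eq_succ (n : ℕ) (x : ℝ) :
    dleg n x = (1 - 2 * x) * dleg (n + 1) x + 2 * (n + 1) * (leg (n + 1)).eval x := by
  linear_combination mul_dleg_add n x + sub_one_mul_dleg_sub n x

lemma dleg_pred_sub_dleg_succ (n : ℕ) (x : ℝ) :
    dleg (n - 1) x - dleg (n + 1) x = 2 * (2 * n + 1) * (leg n).eval x := by
  cases n with
  | zero =>
    have := dleg_succ 0 x
    have h0 : dleg 0 x = 0 := by simp [dleg, leg_zero]
    simp [leg_zero, h0] at this ⊢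
    linarith
  | succ n =>
    have h1 := dleg_eq_succ n x
    have h2 := dleg_succ (n + 1) x
    simp only [Nat.add_sub_cancel]
    push_cast at h2 ⊢
    linear_combination h1 - h2

lemma mul_dleg (n : ℕ) (x : ℝ) :
    2 * (x * (1 - x)) * dleg n x =
      (n + 1) * ((leg (n + 1)).eval x - (1 - 2 * x) * (leg n).eval x) := by
  linear_combination (1 - x) * mul_dleg_add n x + x * sub_one_mul_dleg_sub n x

/-- Legendre's differential equation. -/
lemma hasDerivAt_mul_dleg (n : ℕ) (x : ℝ) :
    HasDerivAt (fun y => y * (1 - y) * dleg n y) (-(n * (n + 1)) * (leg n).eval x) x := by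
  have h : (fun y => y * (1 - y) * dleg n y) = fun y =>
      ((n + 1) / 2 : ℝ) * ((leg (n + 1)).eval y - (1 - 2 * y) * (leg n).eval y) := by
    funext y; linear_combination (1 / 2) * mul_dleg n y
  rw [h]
  have h1 : HasDerivAt (fun y : ℝ => 1 - 2 * y) (-2) x := by
    simpa using ((hasDerivAt_id x).const_mul (2 : ℝ)).const_sub 1
  convert! ((hasDerivAt_leg (n + 1) x).sub (h1.mul (hasDerivAt_leg n x))).const_mul
    ((n + 1) / 2 : ℝ) using 1
  rw [dleg_succ]; ring

lemma hasDerivAt_dleg (n : ℕ) (x : ℝ) :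
    HasDerivAt (dleg n) ((leg n).derivative.derivative.eval x) x :=
  (leg n).derivative.hasDerivAt x

lemma legendre_ode (n : ℕ) (x : ℝ) :
    x * (1 - x) * (leg n).derivative.derivative.eval x =
      -(1 - 2 * x) * dleg n x - n * (n + 1) * (leg n).eval x := by
  have h1 : HasDerivAt (fun y : ℝ => y * (1 - y)) (1 - 2 * x) x := by
    convert! (hasDerivAt_id x).mul ((hasDerivAt_id x).const_sub 1) using 1
    simp; ring
  have h := (h1.mul (hasDerivAt_dleg n x)).unique (hasDerivAt_mul_dleg n x)
  linear_combination h

lemma abs_leg_le_one_of_le_half (n : ℕ) {x : ℝ} (hx : x ∈ Icc (0 : ℝ) (1 / 2)) :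
    |(leg n).eval x| ≤ 1 := by
  rcases Nat.eq_zero_or_pos n with rfl | hn
  · simp [leg_zero]
  set l : ℝ := n * (n + 1) with hl
  have hl0 : 0 < l := by positivity
  let F : ℝ → ℝ := fun y => l * (leg n).eval y ^ 2 + y * (1 - y) * dleg n y * dleg n y
  have hF : ∀ y, HasDerivAt F (-(1 - 2 * y) * dleg n y ^ 2) y := by
    intro y
    convert! (((hasDerivAt_leg n y).pow 2).const_mul l).add
      ((hasDerivAt_mul_dleg n y).mul (hasDerivAt_dleg n y)) using 1
    have := legendre_ode n y
    simp only [Nat.cast_ofNat, Nat.reduceSub, pow_one]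
    linear_combination (-dleg n y) * this
  have hanti : AntitoneOn F (Icc 0 (1 / 2)) := by
    apply antitoneOn_of_deriv_nonpos (convex_Icc _ _)
    · exact fun y _ => (hF y).continuousAt.continuousWithinAt
    · exact fun y _ => (hF y).differentiableAt.differentiableWithinAt
    · intro y hy
      rw [interior_Icc] at hy
      rw [(hF y).deriv]
      nlinarith [sq_nonneg (dleg n y), hy.2]
  have h1 : F x ≤ F 0 := hanti ⟨le_rfl, by norm_num⟩ hx hx.1
  have h0 : F 0 = l := by simp [F, leg_eval_zero]
  have h2 : 0 ≤ x * (1 - x) * dleg n x * dleg n x := by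
    have : 0 ≤ x * (1 - x) := mul_nonneg hx.1 (by linarith [hx.2])
    nlinarith [mul_nonneg this (sq_nonneg (dleg n x))]
  have h3 : l * (leg n).eval x ^ 2 ≤ l * 1 := by
    have : F x = l * (leg n).eval x ^ 2 + x * (1 - x) * dleg n x * dleg n x := rfl
    linarith
  exact (sq_le_one_iff_abs_le_one _).1 (le_of_mul_le_mul_left h3 hl0)

lemma abs_leg_le_one (n : ℕ) {x : ℝ} (hx : x ∈ Icc (0 : ℝ) 1) : |(leg n).eval x| ≤ 1 := by
  rcases le_total x (1 / 2) with h | h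
  · exact abs_leg_le_one_of_le_half n ⟨hx.1, h⟩
  · rw [leg_eval_symm, abs_mul, abs_pow, abs_neg, abs_one, one_pow, one_mul]
    exact abs_leg_le_one_of_le_half n ⟨by linarith [hx.2], by linarith⟩

/-- The moment `∫₀¹ (1 - x)^β leg n x dx`. -/
noncomputable def legMoment (β : ℝ) (n : ℕ) : ℝ :=
  ∫ x in (0 : ℝ)..1, (1 - x) ^ β * (leg n).eval x

lemma continuous_one_sub_rpow {β : ℝ} (hβ : 0 ≤ β) : Continuous fun x : ℝ => (1 - x) ^ β :=
  (continuous_const.sub continuous_id).rpow_const fun _ => Or.inr hβ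

lemma hasDerivAt_one_sub_rpow {β : ℝ} (hβ : 0 ≤ β) (x : ℝ) :
    HasDerivAt (fun x : ℝ => (1 - x) ^ (β + 1)) (-((β + 1) * (1 - x) ^ β)) x := by
  convert! ((hasDerivAt_id x).const_sub 1).rpow_const (p := β + 1) (Or.inr (by linarith)) using 1
  simp; ring

lemma legMoment_succ {β : ℝ} (hβ : 0 ≤ β) (n : ℕ) :
    (n + β + 2) * legMoment β (n + 1) = (β - n) * legMoment β n := by
  have hc := continuous_one_sub_rpow hβ
  have hint : ∀ m, IntervalIntegrable (fun x : ℝ => (1 - x) ^ β * (leg m).eval x) volume 0 1 :=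
    fun m => (hc.mul (continuous_leg m)).intervalIntegrable _ _
  have hp := intervalIntegral.integral_mul_deriv_eq_deriv_mul (a := 0) (b := 1)
    (u := fun x : ℝ => (1 - x) ^ (β + 1)) (u' := fun x => -((β + 1) * (1 - x) ^ β))
    (v := fun x => (leg (n + 1)).eval x - (leg n).eval x)
    (v' := fun x => dleg (n + 1) x - dleg n x)
    (fun x _ => hasDerivAt_one_sub_rpow hβ x)
    (fun x _ => (hasDerivAt_leg (n + 1) x).sub (hasDerivAt_leg n x))
    ((continuous_const.mul hc).neg.intervalIntegrable _ _)
    (((continuous_dleg _).sub (continuous_dleg _)).intervalIntegrable _ _)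
  have hl : ∫ x in (0 : ℝ)..1, (1 - x) ^ (β + 1) * (dleg (n + 1) x - dleg n x) =
      -((n + 1) * (legMoment β (n + 1) + legMoment β n)) := by
    rw [legMoment, legMoment, ← intervalIntegral.integral_add (hint _) (hint _),
      ← intervalIntegral.integral_const_mul, ← intervalIntegral.integral_neg]
    apply intervalIntegral.integral_congr
    intro x hx
    rw [uIcc_of_le zero_le_one] at hx
    simp only
    rcases eq_or_lt_of_le hx.2 with h | h
    · subst h
      simp only [sub_self, leg_eval_one]
      rw [Real.zero_rpow (by linarith), pow_succ]; ring
    rw [Real.rpow_add_one (by linarith)]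
    linear_combination (-(1 - x) ^ β) * sub_one_mul_dleg_sub n x
  have hr : ∫ x in (0 : ℝ)..1, -((β + 1) * (1 - x) ^ β) *
      ((leg (n + 1)).eval x - (leg n).eval x) =
      -((β + 1) * (legMoment β (n + 1) - legMoment β n)) := by
    rw [legMoment, legMoment, ← intervalIntegral.integral_sub (hint _) (hint _),
      ← intervalIntegral.integral_const_mul, ← intervalIntegral.integral_neg]
    apply intervalIntegral.integral_congr
    intro x _
    simp only
    ring
  rw [hl, hr] at hp
  simp only [sub_self, leg_eval_zero, mul_zero, sub_zero] at hp
  rw [Real.zero_rpow (by linarith)] at hp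
  linarith

lemma legMoment_zero {β : ℝ} (hβ : 0 ≤ β) : legMoment β 0 = 1 / (β + 1) := by
  have h : ∫ x in (0 : ℝ)..1, -((β + 1) * (1 - x) ^ β) = 0 - 1 := by
    rw [intervalIntegral.integral_eq_sub_of_hasDerivAt
      (fun x _ => hasDerivAt_one_sub_rpow hβ x)
      ((continuous_const.mul (continuous_one_sub_rpow hβ)).neg.intervalIntegrable _ _)]
    rw [sub_self, Real.zero_rpow (by linarith)]; simp
  rw [intervalIntegral.integral_neg, intervalIntegral.integral_const_mul] at h
  have : β + 1 ≠ 0 := by linarith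
  simp only [legMoment, leg_zero, Polynomial.eval_one, mul_one]
  field_simp
  linarith

lemma legMoment_natCast_eq_zero {j n : ℕ} (h : j < n) : legMoment j n = 0 := by
  induction n, h using Nat.le_induction with
  | base =>
    have := legMoment_succ (Nat.cast_nonneg j : (0 : ℝ) ≤ j) j
    rw [sub_self, zero_mul] at this
    exact (mul_eq_zero.1 this).resolve_left (by positivity)
  | succ n _ ih =>
    have := legMoment_succ (Nat.cast_nonneg j : (0 : ℝ) ≤ j) n
    rw [ih, mul_zero] at this
    exact (mul_eq_zero.1 this).resolve_left (by positivity)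

open Polynomial in
lemma integral_mul_leg_eq_zero {n : ℕ} {v : ℝ[X]} (hv : v.natDegree < n) :
    ∫ x in (0 : ℝ)..1, v.eval x * (leg n).eval x = 0 := by
  set w := v.comp (1 - X) with hw
  have hwd : w.natDegree < n := by
    have h1 : (1 - X : ℝ[X]).natDegree ≤ 1 := by
      refine (natDegree_sub_le _ _).trans ?_; simp
    calc w.natDegree ≤ v.natDegree * (1 - X : ℝ[X]).natDegree := natDegree_comp_le
      _ ≤ v.natDegree * 1 := by gcongr
      _ < n := by lia
  have h : ∀ x : ℝ, v.eval x * (leg n).eval x =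
      ∑ j ∈ Finset.range n, w.coeff j * ((1 - x) ^ (j : ℝ) * (leg n).eval x) := by
    intro x
    have : v.eval x = w.eval (1 - x) := by simp [hw, eval_comp]
    rw [this, eval_eq_sum_range' hwd, Finset.sum_mul]
    refine Finset.sum_congr rfl fun j _ => ?_
    rw [Real.rpow_natCast]; ring
  simp_rw [h]
  rw [intervalIntegral.integral_finsetSum]
  · refine Finset.sum_eq_zero fun j hj => ?_
    rw [intervalIntegral.integral_const_mul]
    have := legMoment_natCast_eq_zero (Finset.mem_range.1 hj)
    rw [legMoment] at this
    rw [this, mul_zero]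
  · intro j _
    exact (continuous_const.mul ((continuous_one_sub_rpow (Nat.cast_nonneg j)).mul
      (continuous_leg n))).intervalIntegrable _ _

lemma integral_leg_mul_leg_of_ne {n m : ℕ} (h : n ≠ m) :
    ∫ x in (0 : ℝ)..1, (leg n).eval x * (leg m).eval x = 0 := by
  rcases lt_or_gt_of_ne h with h | h
  · exact integral_mul_leg_eq_zero (by rwa [natDegree_leg])
  · simp_rw [mul_comm ((leg n).eval _)]
    exact integral_mul_leg_eq_zero (by rwa [natDegree_leg])

lemma integral_dleg_mul_leg_eq_zero {n m : ℕ} (h : n ≤ m) :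
    ∫ x in (0 : ℝ)..1, dleg n x * (leg m).eval x = 0 := by
  rcases Nat.eq_zero_or_pos n with rfl | hn
  · simp [dleg, leg_zero]
  apply integral_mul_leg_eq_zero
  calc (leg n).derivative.natDegree ≤ (leg n).natDegree - 1 := Polynomial.natDegree_derivative_le _
    _ < m := by rw [natDegree_leg]; lia

lemma integral_leg_sq (n : ℕ) :
    ∫ x in (0 : ℝ)..1, (leg n).eval x * (leg n).eval x = 1 / (2 * n + 1) := by
  have hp := intervalIntegral.integral_mul_deriv_eq_deriv_mul (a := 0) (b := 1)
    (fun x _ => hasDerivAt_leg n x) (fun x _ => hasDerivAt_leg (n + 1) x)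
    ((continuous_dleg _).intervalIntegrable _ _) ((continuous_dleg _).intervalIntegrable _ _)
  rw [integral_dleg_mul_leg_eq_zero (Nat.le_succ n), leg_eval_one, leg_eval_one, leg_eval_zero,
    leg_eval_zero, pow_succ] at hp
  have h2 : ∫ x in (0 : ℝ)..1, (leg n).eval x * dleg (n - 1) x = 0 := by
    simp_rw [mul_comm ((leg n).eval _)]
    exact integral_dleg_mul_leg_eq_zero (Nat.sub_le _ _)
  have h3 : ∫ x in (0 : ℝ)..1, 2 * (2 * n + 1) * ((leg n).eval x * (leg n).eval x) =
      (∫ x in (0 : ℝ)..1, (leg n).eval x * dleg (n - 1) x) -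
      ∫ x in (0 : ℝ)..1, (leg n).eval x * dleg (n + 1) x := by
    rw [← intervalIntegral.integral_sub]
    · apply intervalIntegral.integral_congr
      intro x _
      have := dleg_pred_sub_dleg_succ n x
      simp only
      linear_combination (-(leg n).eval x) * this
    all_goals exact ((continuous_leg _).mul (continuous_dleg _)).intervalIntegrable _ _
  rw [h2, hp, intervalIntegral.integral_const_mul] at h3
  have h4 : ((-1 : ℝ) ^ n) ^ 2 = 1 := by rw [← pow_mul, mul_comm, pow_mul]; simp
  have : (2 * (n : ℝ) + 1) ≠ 0 := by positivity
  rw [eq_div_iff this]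
  linear_combination h3 / 2 + h4 / 2

lemma sq_integral_mul_le {f g : ℝ → ℝ} (hf : Continuous f) (hg : Continuous g) {a b : ℝ}
    (hab : a ≤ b) :
    (∫ x in a..b, f x * g x) ^ 2 ≤ (∫ x in a..b, f x ^ 2) * ∫ x in a..b, g x ^ 2 := by
  have h : ∀ s : ℝ, 0 ≤ (∫ x in a..b, g x ^ 2) * (s * s) + (2 * ∫ x in a..b, f x * g x) * s +
      ∫ x in a..b, f x ^ 2 := by
    intro s
    have h0 : 0 ≤ ∫ x in a..b, (f x + s * g x) ^ 2 :=
      intervalIntegral.integral_nonneg hab fun x _ => sq_nonneg _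
    have h1 : ∫ x in a..b, (f x + s * g x) ^ 2 =
        ∫ x in a..b, ((s * s) * g x ^ 2 + (2 * s) * (f x * g x) + f x ^ 2) := by
      congr 1; funext x; ring
    rw [h1, intervalIntegral.integral_add, intervalIntegral.integral_add,
      intervalIntegral.integral_const_mul, intervalIntegral.integral_const_mul] at h0
    · linarith
    all_goals exact Continuous.intervalIntegrable (by fun_prop) _ _
  have := discrim_le_zero h
  rw [discrim] at this
  linarith

/-- The `n`-th (unnormalized) Legendre coefficient on `[0,1]`. -/
noncomputable def legCoeff (f : ℝ → ℝ) (n : ℕ) : ℝ := ∫ x in (0 : ℝ)..1, f x * (leg n).eval x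

/-- The square of the `L²(0,1)` norm. -/
noncomputable def normSq (f : ℝ → ℝ) : ℝ := ∫ x in (0 : ℝ)..1, f x ^ 2

lemma normSq_nonneg (f : ℝ → ℝ) : 0 ≤ normSq f :=
  intervalIntegral.integral_nonneg zero_le_one fun _ _ => sq_nonneg _

open Polynomial in
/-- The `L²(0,1)`-orthogonal projection onto polynomials of degree less than `N`. -/
noncomputable def legProj (f : ℝ → ℝ) (N : ℕ) : ℝ[X] :=
  ∑ n ∈ Finset.range N, C ((2 * n + 1) * legCoeff f n) * leg n

lemma legProj_eval (f : ℝ → ℝ) (N : ℕ) (x : ℝ) :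
    (legProj f N).eval x =
      ∑ n ∈ Finset.range N, (2 * n + 1) * legCoeff f n * (leg n).eval x := by
  simp [legProj, Polynomial.eval_finsetSum]

lemma natDegree_legProj_lt {f : ℝ → ℝ} {N : ℕ} (hN : 0 < N) : (legProj f N).natDegree < N := by
  have : (legProj f N).natDegree ≤ N - 1 := by
    apply Polynomial.natDegree_sum_le_of_forall_le
    intro n hn
    refine (Polynomial.natDegree_C_mul_le _ _).trans ?_
    rw [natDegree_leg]
    have := Finset.mem_range.1 hn
    lia
  lia

lemma integral_legProj_mul (f : ℝ → ℝ) {g : ℝ → ℝ} (hg : Continuous g) (N : ℕ) :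
    ∫ x in (0 : ℝ)..1, (legProj f N).eval x * g x =
      ∑ n ∈ Finset.range N, (2 * n + 1) * legCoeff f n * legCoeff g n := by
  simp_rw [legProj_eval, Finset.sum_mul]
  rw [intervalIntegral.integral_finsetSum]
  · refine Finset.sum_congr rfl fun n _ => ?_
    rw [legCoeff.eq_1 g, ← intervalIntegral.integral_const_mul]
    congr 1; funext x; ring
  · intro n _
    exact ((continuous_const.mul (continuous_leg n)).mul hg).intervalIntegrable _ _

lemma legCoeff_leg (n m : ℕ) :
    legCoeff (fun x => (leg n).eval x) m = if n = m then 1 / (2 * (m : ℝ) + 1) else 0 := by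
  split_ifs with h
  · subst h; exact integral_leg_sq n
  · exact integral_leg_mul_leg_of_ne h

lemma legCoeff_sub {f g : ℝ → ℝ} (hf : Continuous f) (hg : Continuous g) (n : ℕ) :
    legCoeff (fun x => f x - g x) n = legCoeff f n - legCoeff g n := by
  have := continuous_leg n
  rw [legCoeff, legCoeff, legCoeff, ← intervalIntegral.integral_sub]
  · congr 1; funext x; ring
  all_goals exact Continuous.intervalIntegrable (by fun_prop) _ _

lemma legCoeff_legProj (f : ℝ → ℝ) (N m : ℕ) :
    legCoeff (fun x => (legProj f N).eval x) m = if m < N then legCoeff f m else 0 := by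
  rw [legCoeff, integral_legProj_mul f (continuous_leg m)]
  simp_rw [fun n => (show legCoeff (fun x => (leg m).eval x) n = if n = m then
    1 / (2 * (m : ℝ) + 1) else 0 by rw [legCoeff_leg]; split_ifs <;> simp_all)]
  simp only [mul_ite, mul_zero, Finset.sum_ite_eq', Finset.mem_range]
  split_ifs with h
  · have : (2 * (m : ℝ) + 1) ≠ 0 := by positivity
    field_simp
  · rfl

lemma legCoeff_sub_legProj {f : ℝ → ℝ} (hf : Continuous f) (N n : ℕ) :
    legCoeff (fun x => f x - (legProj f N).eval x) n = if n < N then 0 else legCoeff f n := by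
  rw [legCoeff_sub hf (Polynomial.continuous _), legCoeff_legProj]
  split_ifs <;> simp

open Polynomial in
lemma integral_mul_eval_eq_zero {g : ℝ → ℝ} (hg : Continuous g) {N : ℕ}
    (h : ∀ n < N, legCoeff g n = 0) {v : ℝ[X]} (hv : v.natDegree < N) :
    ∫ x in (0 : ℝ)..1, g x * v.eval x = 0 := by
  induction N generalizing v with
  | zero => simp at hv
  | succ N ih =>
    set c : ℝ := v.coeff N / (leg N).coeff N with hc
    have hl : (leg N).coeff N ≠ 0 := by
      have h1 : (leg N).leadingCoeff ≠ 0 := by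
        rw [Ne, leadingCoeff_eq_zero]
        intro h0
        have := leg_eval_zero N
        rw [h0] at this; simp at this
      rwa [leadingCoeff, natDegree_leg] at h1
    have hsplit : ∫ x in (0 : ℝ)..1, g x * v.eval x =
        (∫ x in (0 : ℝ)..1, g x * (v - C c * leg N).eval x) + c * legCoeff g N := by
      rw [legCoeff, ← intervalIntegral.integral_const_mul, ← intervalIntegral.integral_add]
      · congr 1; funext x; simp; ring
      all_goals exact Continuous.intervalIntegrable (by fun_prop) _ _
    rw [hsplit, h N (Nat.lt_succ_self N), mul_zero, add_zero]
    rcases Nat.eq_zero_or_pos N with rfl | hN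
    · have : v - C c * leg 0 = 0 := by
        rw [eq_C_of_natDegree_eq_zero (Nat.lt_one_iff.1 hv), leg_zero, hc, leg_zero]
        simp
      simp [this]
    · apply ih (fun n hn => h n (hn.trans (Nat.lt_succ_self N)))
      have h1 : (v - C c * leg N).natDegree ≤ N := by
        refine (natDegree_sub_le _ _).trans (max_le (Nat.lt_succ_iff.1 hv) ?_)
        exact (natDegree_C_mul_le _ _).trans (natDegree_leg N).le
      refine lt_of_le_of_ne h1 fun h2 => ?_
      have h3 : (v - C c * leg N).coeff N = 0 := by
        rw [coeff_sub, coeff_C_mul, hc, div_mul_cancel₀ _ hl, sub_self]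
      have h4 : v - C c * leg N = 0 := leadingCoeff_eq_zero.1 (by rw [leadingCoeff, h2, h3])
      rw [h4] at h2
      simp at h2; lia

lemma integral_sub_legProj_mul {f : ℝ → ℝ} (hf : Continuous f) {N : ℕ} {v : Polynomial ℝ}
    (hv : v.natDegree < N) :
    ∫ x in (0 : ℝ)..1, (f x - (legProj f N).eval x) * v.eval x = 0 :=
  integral_mul_eval_eq_zero (g := fun x => f x - (legProj f N).eval x)
    (hf.sub (Polynomial.continuous _)) (fun n hn => by rw [legCoeff_sub_legProj hf, if_pos hn]) hv

lemma normSq_sub_legProj {f : ℝ → ℝ} (hf : Continuous f) {N : ℕ} (hN : 0 < N) :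
    normSq (fun x => f x - (legProj f N).eval x) =
      normSq f - ∑ n ∈ Finset.range N, (2 * n + 1) * legCoeff f n ^ 2 := by
  have h1 := integral_sub_legProj_mul hf (natDegree_legProj_lt (f := f) hN)
  have h2 := integral_legProj_mul f hf N
  have h3 : normSq (fun x => f x - (legProj f N).eval x) =
      normSq f - (∫ x in (0 : ℝ)..1, (legProj f N).eval x * f x) -
        ∫ x in (0 : ℝ)..1, (f x - (legProj f N).eval x) * (legProj f N).eval x := by
    rw [normSq, normSq, ← intervalIntegral.integral_sub, ← intervalIntegral.integral_sub]
    · congr 1; funext x; ring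
    all_goals exact Continuous.intervalIntegrable (by fun_prop) _ _
  rw [h3, h1, h2, sub_zero]
  congr 1
  exact Finset.sum_congr rfl fun n _ => by ring

/-- Bessel's inequality. -/
lemma sum_legCoeff_sq_le {f : ℝ → ℝ} (hf : Continuous f) (N : ℕ) :
    ∑ n ∈ Finset.range N, (2 * n + 1) * legCoeff f n ^ 2 ≤ normSq f := by
  rcases Nat.eq_zero_or_pos N with rfl | hN
  · simpa using normSq_nonneg f
  · linarith [normSq_sub_legProj hf hN, normSq_nonneg fun x => f x - (legProj f N).eval x]

/-- Completeness of the Legendre polynomials. -/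
lemma normSq_le_of_sum_le {f : ℝ → ℝ} (hf : Continuous f) {M : ℝ}
    (h : ∀ N, ∑ n ∈ Finset.range N, (2 * n + 1) * legCoeff f n ^ 2 ≤ M) : normSq f ≤ M := by
  apply le_of_forall_pos_le_add
  intro ε hε
  obtain ⟨q, hq⟩ := exists_polynomial_near_of_continuousOn 0 1 f hf.continuousOn (√ε)
    (Real.sqrt_pos.2 hε)
  set N := q.natDegree + 1 with hN
  set S := legProj f N with hS
  have hS1 : S.natDegree < N := natDegree_legProj_lt (Nat.succ_pos _)
  have h1 : normSq (fun x => f x - q.eval x) =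
      normSq (fun x => f x - S.eval x) + normSq (fun x => S.eval x - q.eval x) +
        2 * ∫ x in (0 : ℝ)..1, (f x - S.eval x) * (S - q).eval x := by
    rw [normSq, normSq, normSq, ← intervalIntegral.integral_const_mul,
      ← intervalIntegral.integral_add, ← intervalIntegral.integral_add]
    · congr 1; funext x; simp only [Polynomial.eval_sub]; ring
    all_goals exact Continuous.intervalIntegrable (by fun_prop) _ _
  rw [integral_sub_legProj_mul hf ((Polynomial.natDegree_sub_le _ _).trans_lt
    (max_lt hS1 (Nat.lt_succ_self _))), normSq_sub_legProj hf (Nat.succ_pos _)] at h1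
  have h2 : normSq (fun x => f x - q.eval x) ≤ ε := by
    have : ∫ x in (0 : ℝ)..1, (f x - q.eval x) ^ 2 ≤ ∫ x in (0 : ℝ)..1, ε := by
      apply intervalIntegral.integral_mono_on zero_le_one
      · exact Continuous.intervalIntegrable (by fun_prop) _ _
      · simp
      · intro x hx
        have h3 := (hq x hx).le
        rw [abs_sub_comm] at h3
        calc (f x - q.eval x) ^ 2 = |f x - q.eval x| ^ 2 := (sq_abs _).symm
          _ ≤ √ε ^ 2 := by gcongr
          _ = ε := Real.sq_sqrt hε.le
    simpa [normSq] using this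
  linarith [h N, normSq_nonneg fun x => S.eval x - q.eval x]

/-- The primitive of `f` vanishing at `0`. -/
noncomputable def prim (f : ℝ → ℝ) (x : ℝ) : ℝ := ∫ y in (0 : ℝ)..x, f y

lemma prim_zero (f : ℝ → ℝ) : prim f 0 = 0 := by simp [prim]

lemma hasDerivAt_prim {f : ℝ → ℝ} (hf : Continuous f) (x : ℝ) : HasDerivAt (prim f) (f x) x :=
  intervalIntegral.integral_hasDerivAt_right (hf.intervalIntegrable _ _)
    hf.stronglyMeasurable.stronglyMeasurableAtFilter hf.continuousAt

lemma continuous_prim {f : ℝ → ℝ} (hf : Continuous f) : Continuous (prim f) :=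
  continuous_iff_continuousAt.2 fun x => (hasDerivAt_prim hf x).continuousAt

lemma continuous_iterate_prim {f : ℝ → ℝ} (hf : Continuous f) (s : ℕ) :
    Continuous (prim^[s] f) := by
  induction s with
  | zero => exact hf
  | succ s ih => rw [Function.iterate_succ_apply']; exact continuous_prim ih

lemma prim_one_eq_zero {r : ℝ → ℝ} (h : legCoeff r 0 = 0) : prim r 1 = 0 := by
  simpa [legCoeff, leg_zero, prim] using h

lemma legCoeff_prim {r : ℝ → ℝ} (hr : Continuous r) (h : legCoeff r 0 = 0) (n : ℕ) :
    2 * (2 * n + 1) * legCoeff (prim r) n = legCoeff r (n + 1) - legCoeff r (n - 1) := by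
  have hR := continuous_prim hr
  have hc := continuous_leg (n + 1)
  have hc' := continuous_leg (n - 1)
  have hd := continuous_dleg (n + 1)
  have hd' := continuous_dleg (n - 1)
  have hp := intervalIntegral.integral_mul_deriv_eq_deriv_mul (a := 0) (b := 1)
    (fun x _ => hasDerivAt_prim hr x)
    (fun x _ => (hasDerivAt_leg (n - 1) x).sub (hasDerivAt_leg (n + 1) x))
    (hr.intervalIntegrable _ _) ((hd'.sub hd).intervalIntegrable _ _)
  simp only [Pi.sub_apply] at hp
  rw [prim_zero, prim_one_eq_zero h] at hp
  have h1 : ∫ x in (0 : ℝ)..1, r x * ((leg (n - 1)).eval x - (leg (n + 1)).eval x) =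
      legCoeff r (n - 1) - legCoeff r (n + 1) := by
    rw [legCoeff, legCoeff, ← intervalIntegral.integral_sub]
    · congr 1; funext x; ring
    all_goals exact Continuous.intervalIntegrable (by fun_prop) _ _
  rw [h1] at hp
  simp_rw [dleg_pred_sub_dleg_succ] at hp
  rw [legCoeff, ← intervalIntegral.integral_const_mul]
  calc _ = ∫ x in (0 : ℝ)..1, prim r x * (2 * (2 * n + 1) * (leg n).eval x) := by
        congr 1; funext x; ring
    _ = _ := by rw [hp]; ring

lemma legCoeff_prim_eq_zero {r : ℝ → ℝ} (hr : Continuous r) {q : ℕ}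
    (h : ∀ n < q, legCoeff r n = 0) {n : ℕ} (hn : n + 1 < q) : legCoeff (prim r) n = 0 := by
  have h1 := legCoeff_prim hr (h 0 (by lia)) n
  rw [h (n + 1) hn, h (n - 1) (by lia), sub_zero] at h1
  exact (mul_eq_zero.1 h1).resolve_left (by positivity)

/-- Poincaré inequality for functions orthogonal to polynomials of degree less than `q`. -/
lemma normSq_prim_le {r : ℝ → ℝ} (hr : Continuous r) {q : ℕ} (hq : 0 < q)
    (h : ∀ n < q, legCoeff r n = 0) : normSq (prim r) ≤ normSq r / q ^ 2 := by
  have hq' : (0 : ℝ) < q := by positivity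
  set d := legCoeff r with hd
  let w : ℕ → ℝ := fun n => (2 * n + 1) * d n ^ 2
  have hw0 : ∀ n, 0 ≤ w n := fun n => by positivity
  have key : ∀ n, (2 * n + 1) * legCoeff (prim r) n ^ 2 ≤
      (w (n + 1) + if n = 0 then 0 else w (n - 1)) / (2 * q ^ 2) := by
    intro n
    have h1 := legCoeff_prim hr (h 0 hq) n
    rw [← hd] at h1
    set e := legCoeff (prim r) n
    have hn1 : (0 : ℝ) < 2 * n + 1 := by positivity
    have h2 : (2 * (n : ℝ) + 1) * e ^ 2 = (d (n + 1) - d (n - 1)) ^ 2 / (4 * (2 * n + 1)) := by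
      rw [← h1]; field_simp; ring
    have h3 : d (n + 1) ^ 2 / (2 * (2 * n + 1)) ≤ w (n + 1) / (2 * q ^ 2) := by
      by_cases hn : n + 1 < q
      · rw [h _ hn]; simp only [ne_eq, OfNat.ofNat_ne_zero, not_false_eq_true, zero_pow,
          zero_div]; exact div_nonneg (hw0 _) (by positivity)
      · have hnq : (q : ℝ) ≤ n + 1 := by exact_mod_cast not_lt.1 hn
        have hq1 : (1 : ℝ) ≤ q := by exact_mod_cast hq
        rw [div_le_div_iff₀ (by positivity) (by positivity)]
        have : (q : ℝ) ^ 2 ≤ (2 * (n + 1) + 1) * (2 * n + 1) := by nlinarith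
        have h4 := mul_le_mul_of_nonneg_left this (sq_nonneg (d (n + 1)))
        simp only [w]; push_cast; nlinarith
    have h4 : d (n - 1) ^ 2 / (2 * (2 * n + 1)) ≤
        (if n = 0 then 0 else w (n - 1)) / (2 * q ^ 2) := by
      by_cases hn : n - 1 < q
      · rw [h _ hn]; simp only [ne_eq, OfNat.ofNat_ne_zero, not_false_eq_true, zero_pow,
          zero_div]
        apply div_nonneg _ (by positivity)
        split_ifs <;> simp [hw0]
      · obtain ⟨k, rfl⟩ : ∃ k, n = k + 1 := ⟨n - 1, by lia⟩
        have hnq : (q : ℝ) ≤ k := by exact_mod_cast not_lt.1 hn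
        rw [if_neg (by lia), div_le_div_iff₀ (by positivity) (by positivity)]
        simp only [Nat.add_sub_cancel, w]
        have : (q : ℝ) ^ 2 ≤ (2 * k + 1) * (2 * (k + 1) + 1) := by nlinarith
        have h4 := mul_le_mul_of_nonneg_left this (sq_nonneg (d k))
        push_cast; nlinarith
    calc (2 * (n : ℝ) + 1) * e ^ 2 = (d (n + 1) - d (n - 1)) ^ 2 / (4 * (2 * n + 1)) := h2
      _ ≤ (2 * d (n + 1) ^ 2 + 2 * d (n - 1) ^ 2) / (4 * (2 * n + 1)) := by
          gcongr; nlinarith [sq_nonneg (d (n + 1) + d (n - 1))]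
      _ = d (n + 1) ^ 2 / (2 * (2 * n + 1)) + d (n - 1) ^ 2 / (2 * (2 * n + 1)) := by
          field_simp; ring
      _ ≤ _ := by rw [add_div]; exact add_le_add h3 h4
  apply normSq_le_of_sum_le (continuous_prim hr)
  intro N
  refine (Finset.sum_le_sum fun n _ => key n).trans ?_
  rw [← Finset.sum_div, Finset.sum_add_distrib]
  have h1 : ∑ n ∈ Finset.range N, w (n + 1) ≤ normSq r := by
    have := sum_legCoeff_sq_le hr (N + 1)
    rw [Finset.sum_range_succ'] at this
    have h0 := hw0 0
    simp only [w, ← hd] at h0 ⊢ this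
    linarith
  have h2 : ∑ n ∈ Finset.range N, (if n = 0 then 0 else w (n - 1)) ≤ normSq r := by
    cases N with
    | zero => simpa using normSq_nonneg r
    | succ N =>
      rw [Finset.sum_range_succ']
      simpa [w] using sum_legCoeff_sq_le hr N
  calc _ ≤ (normSq r + normSq r) / (2 * q ^ 2) := by gcongr
    _ = _ := by field_simp; ring

lemma legCoeff_iterate_prim_eq_zero {r : ℝ → ℝ} (hr : Continuous r) {q : ℕ}
    (h : ∀ n < q, legCoeff r n = 0) (s : ℕ) : ∀ n, n + s < q → legCoeff (prim^[s] r) n = 0 := by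
  induction s with
  | zero => simpa using h
  | succ s ih =>
    intro n hn
    rw [Function.iterate_succ_apply']
    exact legCoeff_prim_eq_zero (continuous_iterate_prim hr s) (q := q - s)
      (fun j hj => ih j (by lia)) (by lia)

lemma normSq_iterate_prim_le {r : ℝ → ℝ} (hr : Continuous r) {q : ℕ}
    (h : ∀ n < q, legCoeff r n = 0) (s : ℕ) (hs : s ≤ q) :
    normSq (prim^[s] r) ≤ (s.factorial : ℝ) ^ 2 / q ^ (2 * s) * normSq r := by
  induction s with
  | zero => simp
  | succ s ih =>
    rw [Function.iterate_succ_apply']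
    have h1 := normSq_prim_le (continuous_iterate_prim hr s) (q := q - s) (by lia)
      (fun j hj => legCoeff_iterate_prim_eq_zero hr h s j (by lia))
    have hq : (0 : ℝ) < q := by exact_mod_cast (by lia : 0 < q)
    have hqs : (q : ℝ) / (s + 1) ≤ ((q - s : ℕ) : ℝ) := by
      rw [Nat.cast_sub (by lia), div_le_iff₀ (by positivity)]
      have : (s : ℝ) + 1 ≤ q := by exact_mod_cast hs
      have h0 : (0 : ℝ) ≤ s := by positivity
      nlinarith
    calc normSq (prim (prim^[s] r)) ≤ normSq (prim^[s] r) / ((q - s : ℕ) : ℝ) ^ 2 := h1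
      _ ≤ ((s.factorial : ℝ) ^ 2 / q ^ (2 * s) * normSq r) / ((q : ℝ) / (s + 1)) ^ 2 := by
          gcongr
          · exact mul_nonneg (by positivity) (normSq_nonneg _)
          · exact ih (by lia)
      _ = _ := by
          rw [Nat.factorial_succ, mul_add, pow_add]; push_cast; field_simp

lemma sq_prim_le {f : ℝ → ℝ} (hf : Continuous f) {x : ℝ} (hx : x ∈ Icc (0 : ℝ) 1) :
    prim f x ^ 2 ≤ 2 * √(normSq (prim f) * normSq f) := by
  have hF := continuous_prim hf
  have h1 : prim f x ^ 2 = 2 * ∫ y in (0 : ℝ)..x, prim f y * f y := by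
    have := intervalIntegral.integral_eq_sub_of_hasDerivAt (a := 0) (b := x)
      (fun y _ => (hasDerivAt_prim hf y).pow 2) (Continuous.intervalIntegrable (by fun_prop) _ _)
    simp only [Pi.pow_apply, prim_zero] at this
    rw [← intervalIntegral.integral_const_mul]
    calc _ = prim f x ^ 2 - 0 ^ 2 := by ring
      _ = _ := by rw [← this]; congr 1; funext y; norm_num; ring
  have h2 := sq_integral_mul_le hF hf hx.1
  have hmono : ∀ g : ℝ → ℝ, Continuous g → ∫ y in (0 : ℝ)..x, g y ^ 2 ≤ normSq g := by
    intro g hg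
    apply intervalIntegral.integral_mono_interval le_rfl hx.1 hx.2
    · exact Eventually.of_forall fun y => sq_nonneg (g y)
    · exact (hg.pow 2).intervalIntegrable _ _
  rw [h1]
  gcongr
  apply Real.le_sqrt_of_sq_le
  refine h2.trans ?_
  exact mul_le_mul (hmono _ hF) (hmono _ hf)
    (intervalIntegral.integral_nonneg hx.1 fun _ _ => sq_nonneg _) (normSq_nonneg _)

lemma abs_prim_le {f : ℝ → ℝ} {A : ℝ} (hA : ∀ x ∈ Icc (0 : ℝ) 1, |f x| ≤ A) {x : ℝ}
    (hx : x ∈ Icc (0 : ℝ) 1) : |prim f x| ≤ A := by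
  have hA0 : 0 ≤ A := (abs_nonneg _).trans (hA x hx)
  have := intervalIntegral.norm_integral_le_of_norm_le_const (a := 0) (b := x) (f := f) (C := A)
    (fun y hy => by
      rw [uIoc_of_le hx.1] at hy
      exact hA y ⟨hy.1.le, hy.2.trans hx.2⟩)
  rw [Real.norm_eq_abs, sub_zero, abs_of_nonneg hx.1] at this
  exact this.trans (mul_le_of_le_one_right hA0 hx.2)

lemma sq_iterate_prim_le_aux {r : ℝ → ℝ} (hr : Continuous r) {q : ℕ}
    (h : ∀ n < q, legCoeff r n = 0) (s : ℕ) (hs : s + 1 ≤ q) {x : ℝ} (hx : x ∈ Icc (0 : ℝ) 1) :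
    (prim^[s + 1] r x) ^ 2 ≤ 2 * ((s + 1).factorial : ℝ) ^ 2 / q ^ (2 * s + 1) * normSq r := by
  have h1 := normSq_iterate_prim_le hr h s (by lia)
  have h2 := normSq_iterate_prim_le hr h (s + 1) hs
  have h3 := sq_prim_le (continuous_iterate_prim hr s) hx
  rw [← Function.iterate_succ_apply' prim s r] at h3
  refine h3.trans ?_
  have hq : (0 : ℝ) < q := by exact_mod_cast (by lia : 0 < q)
  have hf : (s.factorial : ℝ) ≤ (s + 1).factorial := by
    exact_mod_cast Nat.factorial_le (Nat.le_succ s)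
  have hn := normSq_nonneg r
  have : √(normSq (prim^[s + 1] r) * normSq (prim^[s] r)) ≤
      ((s + 1).factorial : ℝ) ^ 2 / q ^ (2 * s + 1) * normSq r := by
    apply Real.sqrt_le_iff.2 ⟨by positivity, ?_⟩
    calc normSq (prim^[s + 1] r) * normSq (prim^[s] r)
        ≤ (((s + 1).factorial : ℝ) ^ 2 / q ^ (2 * (s + 1)) * normSq r) *
          ((s.factorial : ℝ) ^ 2 / q ^ (2 * s) * normSq r) :=
          mul_le_mul h2 h1 (normSq_nonneg _) (by positivity)
      _ ≤ (((s + 1).factorial : ℝ) ^ 2 / q ^ (2 * (s + 1)) * normSq r) *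
          (((s + 1).factorial : ℝ) ^ 2 / q ^ (2 * s) * normSq r) := by gcongr
      _ = _ := by field_simp; ring
  calc _ ≤ 2 * (((s + 1).factorial : ℝ) ^ 2 / q ^ (2 * s + 1) * normSq r) := by gcongr
    _ = _ := by ring

/-- Pointwise decay of iterated primitives of a function orthogonal to low degree polynomials. -/
lemma sq_iterate_prim_le {r : ℝ → ℝ} (hr : Continuous r) {q : ℕ}
    (h : ∀ n < q, legCoeff r n = 0) (s : ℕ) (hs : s ≤ q) (hs1 : 1 ≤ s) {x : ℝ}
    (hx : x ∈ Icc (0 : ℝ) 1) :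
    (prim^[s + 1] r x) ^ 2 ≤ 2 * ((s + 1).factorial : ℝ) ^ 2 / q ^ (2 * s + 1) * normSq r := by
  rcases hs.lt_or_eq with hlt | rfl
  · exact sq_iterate_prim_le_aux hr h s hlt hx
  obtain ⟨s, rfl⟩ : ∃ t, s = t + 1 := ⟨s - 1, by lia⟩
  set B := 2 * ((s + 1).factorial : ℝ) ^ 2 / ((s + 1 : ℕ) : ℝ) ^ (2 * s + 1) * normSq r with hB
  have hn := normSq_nonneg r
  have h1 : ∀ y ∈ Icc (0 : ℝ) 1, |prim^[s + 1] r y| ≤ √B := fun y hy =>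
    Real.abs_le_sqrt (sq_iterate_prim_le_aux hr h s le_rfl hy)
  have h2 := abs_prim_le h1 hx
  rw [← Function.iterate_succ_apply' prim (s + 1) r] at h2
  have hB0 : 0 ≤ B := by positivity
  calc (prim^[s + 1 + 1] r x) ^ 2 = |prim^[s + 1 + 1] r x| ^ 2 := (sq_abs _).symm
    _ ≤ √B ^ 2 := by gcongr
    _ = B := Real.sq_sqrt hB0
    _ ≤ _ := by
      rw [hB, Nat.factorial_succ (s + 1)]
      refine mul_le_mul_of_nonneg_right ?_ hn
      rw [div_le_div_iff₀ (by positivity) (by positivity)]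
      push_cast
      have h3 : ((s : ℝ) + 1) ^ 2 ≤ (s + 1 + 1) ^ 2 := by gcongr; linarith
      have h4 : 0 ≤ 2 * ((s + 1).factorial : ℝ) ^ 2 * (s + 1) ^ (2 * s + 1) := by positivity
      calc 2 * ((s + 1).factorial : ℝ) ^ 2 * (s + 1) ^ (2 * (s + 1) + 1)
          = 2 * ((s + 1).factorial : ℝ) ^ 2 * (s + 1) ^ (2 * s + 1) * (s + 1) ^ 2 := by ring
        _ ≤ 2 * ((s + 1).factorial : ℝ) ^ 2 * (s + 1) ^ (2 * s + 1) * (s + 1 + 1) ^ 2 := by gcongr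
        _ = _ := by ring

lemma prim_leg (n : ℕ) (x : ℝ) :
    prim (fun y => (leg n).eval y) x =
      ((leg (n - 1)).eval x - (leg (n + 1)).eval x) / (2 * (2 * n + 1)) := by
  have h := intervalIntegral.integral_eq_sub_of_hasDerivAt (a := 0) (b := x)
    (fun y _ => (hasDerivAt_leg (n - 1) y).sub (hasDerivAt_leg (n + 1) y))
    (((continuous_dleg _).sub (continuous_dleg _)).intervalIntegrable _ _)
  simp only [Pi.sub_apply, leg_eval_zero, sub_self, sub_zero] at h
  simp_rw [dleg_pred_sub_dleg_succ] at h
  rw [intervalIntegral.integral_const_mul] at h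
  rw [prim, ← h]
  field_simp

lemma iterate_prim_succ_leg (s n : ℕ) (x : ℝ) :
    prim^[s + 1] (fun y => (leg n).eval y) x =
      (prim^[s] (fun y => (leg (n - 1)).eval y) x - prim^[s] (fun y => (leg (n + 1)).eval y) x) /
        (2 * (2 * n + 1)) := by
  induction s generalizing x with
  | zero => simpa using prim_leg n x
  | succ s ih =>
    rw [Function.iterate_succ_apply', prim]
    simp_rw [ih]
    rw [intervalIntegral.integral_div, intervalIntegral.integral_sub
      ((continuous_iterate_prim (continuous_leg _) _).intervalIntegrable _ _)
      ((continuous_iterate_prim (continuous_leg _) _).intervalIntegrable _ _),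
      Function.iterate_succ_apply', Function.iterate_succ_apply', prim, prim]

lemma exists_abs_iterate_prim_leg_le (s : ℕ) :
    ∃ C > (0 : ℝ), ∀ n : ℕ, ∀ x ∈ Icc (0 : ℝ) 1,
      |prim^[s] (fun y => (leg n).eval y) x| ≤ C / ((n : ℝ) + 1) ^ s := by
  induction s with
  | zero => exact ⟨1, one_pos, fun n x hx => by simpa using abs_leg_le_one n hx⟩
  | succ s ih =>
    obtain ⟨C, hC, h⟩ := ih
    refine ⟨C * 2 ^ s, by positivity, fun n x hx => ?_⟩
    rw [iterate_prim_succ_leg, abs_div, abs_of_pos (by positivity : (0 : ℝ) < 2 * (2 * n + 1))]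
    have h1 : |prim^[s] (fun y => (leg (n - 1)).eval y) x| ≤ C * 2 ^ s / ((n : ℝ) + 1) ^ s := by
      refine (h (n - 1) x hx).trans ?_
      have h2 : ((n : ℝ) + 1) / 2 ≤ ((n - 1 : ℕ) : ℝ) + 1 := by
        cases n with
        | zero => norm_num
        | succ n =>
          simp only [Nat.add_sub_cancel]; push_cast
          have : (0 : ℝ) ≤ n := by positivity
          linarith
      calc C / (((n - 1 : ℕ) : ℝ) + 1) ^ s ≤ C / (((n : ℝ) + 1) / 2) ^ s := by gcongr
        _ = _ := by rw [div_pow]; field_simp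
    have h2 : |prim^[s] (fun y => (leg (n + 1)).eval y) x| ≤ C * 2 ^ s / ((n : ℝ) + 1) ^ s := by
      refine (h (n + 1) x hx).trans ?_
      have : (1 : ℝ) ≤ 2 ^ s := one_le_pow₀ (by norm_num)
      calc C / (((n + 1 : ℕ) : ℝ) + 1) ^ s ≤ C / ((n : ℝ) + 1) ^ s := by
            gcongr; linarith
        _ ≤ _ := by gcongr; exact le_mul_of_one_le_right hC.le this
    rw [div_le_iff₀ (by positivity)]
    refine (abs_sub _ _).trans ((add_le_add h1 h2).trans ?_)
    rw [pow_succ]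
    calc _ = C * 2 ^ s / (((n : ℝ) + 1) ^ s * (n + 1)) * (2 * (n + 1)) := by field_simp; ring
      _ ≤ _ := by gcongr; have : (0 : ℝ) ≤ n := by positivity
                  linarith

lemma abs_legMoment_le_one {β : ℝ} (hβ : 0 ≤ β) (n : ℕ) : |legMoment β n| ≤ 1 := by
  have := intervalIntegral.norm_integral_le_of_norm_le_const (a := 0) (b := 1)
    (f := fun x : ℝ => (1 - x) ^ β * (leg n).eval x) (C := 1) (fun y hy => by
      rw [uIoc_of_le zero_le_one] at hy
      rw [norm_mul, Real.norm_eq_abs, Real.norm_eq_abs,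
        abs_of_nonneg (Real.rpow_nonneg (by linarith [hy.2]) _)]
      exact mul_le_one₀ (Real.rpow_le_one (by linarith [hy.2]) (by linarith [hy.1]) hβ)
        (abs_nonneg _) (abs_leg_le_one n ⟨hy.1.le, hy.2⟩))
  simpa [legMoment] using this

lemma abs_legMoment_mul_rpow_succ_le {β : ℝ} (hβ : 0 ≤ β) {n : ℕ} (hn : β ≤ n) :
    |legMoment β (n + 1)| * ((n + 1 : ℕ) + β + 2) ^ (2 * β + 2) ≤
      |legMoment β n| * (n + β + 2) ^ (2 * β + 2) := by
  have hY : (0 : ℝ) < n + β + 2 := by positivity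
  set Y : ℝ := n + β + 2 with hYd
  have h1 : |legMoment β (n + 1)| = (1 - (2 * β + 2) / Y) * |legMoment β n| := by
    have h := congrArg abs (legMoment_succ hβ n)
    rw [abs_mul, abs_mul, ← hYd, abs_of_pos hY, abs_of_nonpos (by linarith : β - n ≤ 0)] at h
    have : (n : ℝ) - β = Y - (2 * β + 2) := by rw [hYd]; ring
    field_simp
    rw [mul_comm, h, neg_sub, this]; ring
  have h2 : (((n + 1 : ℕ) : ℝ) + β + 2) ^ (2 * β + 2) ≤
      Real.exp ((2 * β + 2) / Y) * Y ^ (2 * β + 2) := by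
    have e1 : ((n + 1 : ℕ) : ℝ) + β + 2 ≤ Real.exp (1 / Y) * Y := by
      have := Real.add_one_le_exp (1 / Y)
      calc ((n + 1 : ℕ) : ℝ) + β + 2 = (1 / Y + 1) * Y := by
            field_simp; rw [hYd]; push_cast; ring
        _ ≤ _ := by gcongr
    calc _ ≤ (Real.exp (1 / Y) * Y) ^ (2 * β + 2) := by gcongr
      _ = _ := by
        rw [Real.mul_rpow (Real.exp_pos _).le hY.le, ← Real.exp_mul]
        congr 2; ring
  have h3 : 1 - (2 * β + 2) / Y ≤ Real.exp (-((2 * β + 2) / Y)) := by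
    linarith [Real.add_one_le_exp (-((2 * β + 2) / Y))]
  calc _ ≤ (Real.exp (-((2 * β + 2) / Y)) * |legMoment β n|) *
        (Real.exp ((2 * β + 2) / Y) * Y ^ (2 * β + 2)) := by
        rw [h1]; gcongr
    _ = (Real.exp (-((2 * β + 2) / Y)) * Real.exp ((2 * β + 2) / Y)) *
        (|legMoment β n| * Y ^ (2 * β + 2)) := by ring
    _ = _ := by rw [← Real.exp_add]; simp

/-- Decay of the Legendre coefficients of an endpoint singularity. -/
lemma exists_abs_legMoment_le {β : ℝ} (hβ : 0 ≤ β) :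
    ∃ C > (0 : ℝ), ∀ n : ℕ, 0 < n →
      (n + β + 1) * |legMoment β n| ≤ C * (n : ℝ) ^ (-(2 * β + 1)) := by
  set N := ⌈β⌉₊ with hN
  refine ⟨((N : ℝ) + β + 2) ^ (2 * β + 2), by positivity, fun n hn => ?_⟩
  have hn' : (0 : ℝ) < n := by exact_mod_cast hn
  have key : |legMoment β n| * (n + β + 2) ^ (2 * β + 2) ≤ ((N : ℝ) + β + 2) ^ (2 * β + 2) := by
    have hsmall : ∀ j ≤ N, |legMoment β j| * (j + β + 2) ^ (2 * β + 2) ≤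
        ((N : ℝ) + β + 2) ^ (2 * β + 2) := fun j hj => by
      have hj' : (j : ℝ) ≤ N := by exact_mod_cast hj
      calc _ ≤ 1 * ((N : ℝ) + β + 2) ^ (2 * β + 2) := by
            gcongr; exact abs_legMoment_le_one hβ j
        _ = _ := one_mul _
    rcases le_total n N with h | h
    · exact hsmall n h
    · induction n, h using Nat.le_induction with
      | base => exact hsmall N le_rfl
      | succ j hj ih =>
        have hβj : β ≤ j := (Nat.le_ceil β).trans (by exact_mod_cast hj)
        rcases Nat.eq_zero_or_pos j with rfl | hj0
        · refine (abs_legMoment_mul_rpow_succ_le hβ hβj).trans ?_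
          exact hsmall 0 (Nat.zero_le _)
        · exact (abs_legMoment_mul_rpow_succ_le hβ hβj).trans
            (ih hj0 (by exact_mod_cast hj0))
  have hY : (0 : ℝ) < n + β + 2 := by positivity
  calc (n + β + 1) * |legMoment β n| ≤ (n + β + 2) * |legMoment β n| := by gcongr; norm_num
    _ = (|legMoment β n| * (n + β + 2) ^ (2 * β + 2)) * ((n : ℝ) + β + 2) ^ (-(2 * β + 1)) := by
        rw [mul_assoc, ← Real.rpow_add hY, show 2 * β + 2 + -(2 * β + 1) = 1 by ring,
          Real.rpow_one, mul_comm]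
    _ ≤ ((N : ℝ) + β + 2) ^ (2 * β + 2) * (n : ℝ) ^ (-(2 * β + 1)) := by
        refine mul_le_mul key ?_ (by positivity) (by positivity)
        exact Real.rpow_le_rpow_of_nonpos hn' (by linarith) (by linarith)

lemma sum_legMoment {β : ℝ} (hβ : 0 ≤ β) (p : ℕ) :
    ∑ n ∈ Finset.range p, (2 * n + 1) * legMoment β n = 1 - (p + β + 1) * legMoment β p := by
  induction p with
  | zero => rw [legMoment_zero hβ]; simp; field_simp; ring
  | succ p ih =>
    rw [Finset.sum_range_succ, ih]
    have := legMoment_succ hβ p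
    push_cast
    linarith

lemma sum_legMoment_sq {β : ℝ} (hβ : 0 ≤ β) (p j : ℕ) :
    ∑ n ∈ Finset.range (p + j), (2 * n + 1) * (if n < p then 0 else legMoment β n) ^ 2 =
      ((p + β + 1) ^ 2 * legMoment β p ^ 2 -
        ((p + j : ℕ) + β + 1) ^ 2 * legMoment β (p + j) ^ 2) / (2 * β + 1) := by
  induction j with
  | zero =>
    simp only [add_zero, sub_self, zero_div]
    exact Finset.sum_eq_zero fun n hn => by simp [Finset.mem_range.1 hn]
  | succ j ih =>
    rw [← add_assoc, Finset.sum_range_succ, ih, if_neg (by lia)]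
    have h : (((p + j : ℕ) : ℝ) + 1 + β + 1) ^ 2 * legMoment β (p + j + 1) ^ 2 =
        (β - (p + j : ℕ)) ^ 2 * legMoment β (p + j) ^ 2 := by
      rw [← mul_pow, ← mul_pow, ← legMoment_succ hβ]; ring
    rw [Nat.cast_add_one (p + j), h]
    field_simp
    ring

/-- A function orthogonal to low degree polynomials is almost orthogonal to `(1-x)^β`. -/
lemma exists_abs_integral_one_sub_rpow_mul_le {β : ℝ} (hβ : 0 ≤ β) :
    ∃ C > (0 : ℝ), ∀ p : ℕ, 0 < p →
      |1 - ∑ n ∈ Finset.range p, (2 * n + 1) * legMoment β n| ≤ C * (p : ℝ) ^ (-(2 * β + 1)) ∧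
      ∀ r : ℝ → ℝ, Continuous r → (∀ n < p, legCoeff r n = 0) →
        |∫ x in (0 : ℝ)..1, (1 - x) ^ β * r x| ≤ C * (p : ℝ) ^ (-(2 * β + 1)) * √(normSq r) := by
  obtain ⟨C, hC, h⟩ := exists_abs_legMoment_le hβ
  refine ⟨C, hC, fun p hp => ⟨?_, fun r hr hr0 => ?_⟩⟩
  · rw [sum_legMoment hβ, sub_sub_cancel, abs_mul, abs_of_pos (by positivity)]
    exact h p hp
  have hc := continuous_one_sub_rpow hβ
  set f : ℝ → ℝ := fun x => (1 - x) ^ β with hf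
  have hP : ∫ x in (0 : ℝ)..1, f x * r x =
      ∫ x in (0 : ℝ)..1, (f x - (legProj f p).eval x) * r x := by
    have h0 := integral_mul_eval_eq_zero hr hr0 (natDegree_legProj_lt (f := f) hp)
    have hPc := (legProj f p).continuous
    have e : ∀ x, (f x - (legProj f p).eval x) * r x =
        f x * r x - r x * (legProj f p).eval x := fun x => by ring
    simp_rw [e]
    rw [intervalIntegral.integral_sub, h0, sub_zero]
    · exact (hc.mul hr).intervalIntegrable _ _
    · exact (hr.mul hPc).intervalIntegrable _ _
  have hg : Continuous fun x => f x - (legProj f p).eval x := hc.sub (Polynomial.continuous _)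
  have hN : normSq (fun x => f x - (legProj f p).eval x) ≤
      ((p + β + 1) * |legMoment β p|) ^ 2 := by
    refine normSq_le_of_sum_le hg fun N => ?_
    have h1 : ∀ n, legCoeff (fun x => f x - (legProj f p).eval x) n =
        if n < p then 0 else legMoment β n := fun n => legCoeff_sub_legProj hc p n
    simp_rw [h1]
    calc _ ≤ ∑ n ∈ Finset.range (p + N), (2 * (n : ℝ) + 1) *
          (if n < p then 0 else legMoment β n) ^ 2 :=
          Finset.sum_le_sum_of_subset_of_nonneg (Finset.range_mono (by lia))
            fun _ _ _ => by positivity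
      _ ≤ (p + β + 1) ^ 2 * legMoment β p ^ 2 / (2 * β + 1) := by
          rw [sum_legMoment_sq hβ]
          gcongr
          exact sub_le_self _ (by positivity)
      _ ≤ (p + β + 1) ^ 2 * legMoment β p ^ 2 := div_le_self (by positivity) (by linarith)
      _ = _ := by rw [mul_pow, sq_abs]
  have hcs := sq_integral_mul_le hg hr zero_le_one
  rw [hP]
  refine (Real.abs_le_sqrt hcs).trans ?_
  change √(normSq _ * normSq r) ≤ _
  rw [Real.sqrt_mul (normSq_nonneg _)]
  gcongr
  exact (Real.sqrt_le_sqrt hN).trans (by rw [Real.sqrt_sq (by positivity)]; exact h p hp)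

lemma intervalIntegrable_sub_rpow {β : ℝ} (hβ : -1 < β) (t a b : ℝ) :
    IntervalIntegrable (fun y => (t - y) ^ β) volume a b := by
  have := (intervalIntegral.intervalIntegrable_rpow' (a := t - a) (b := t - b) hβ).comp_sub_left t
  simpa using this

lemma integral_sub_rpow {β : ℝ} (hβ : 0 < β) (c t : ℝ) :
    ∫ y in c..t, (t - y) ^ (β - 1) = (t - c) ^ β / β := by
  rw [intervalIntegral.integral_comp_sub_left (fun z => z ^ (β - 1)) t,
    integral_rpow (Or.inl (by linarith)), sub_self, sub_add_cancel, Real.zero_rpow hβ.ne', sub_zero]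

lemma hasDerivAt_sub_rpow {β t y : ℝ} (h : t - y ≠ 0) :
    HasDerivAt (fun y => (t - y) ^ β) (-(β * (t - y) ^ (β - 1))) y := by
  convert! ((hasDerivAt_id y).const_sub t).rpow_const (p := β) (Or.inl h) using 1
  simp

lemma integral_sub_rpow_mul_deriv {β : ℝ} (hβ : 0 < β) {F F' : ℝ → ℝ}
    (hF : ∀ x, HasDerivAt F (F' x) x) (hF' : Continuous F') {t : ℝ} (ht : 0 ≤ t) :
    ∫ y in (0 : ℝ)..t, (t - y) ^ β * F' y =
      β * (∫ y in (0 : ℝ)..t, (t - y) ^ (β - 1) * F y) - t ^ β * F 0 := by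
  have hFc : Continuous F := continuous_iff_continuousAt.2 fun x => (hF x).continuousAt
  rw [intervalIntegral.integral_mul_deriv_eq_deriv_mul_of_hasDerivAt
    (u := fun y => (t - y) ^ β) (u' := fun y => -(β * (t - y) ^ (β - 1))) (v := F)]
  · simp only [sub_self, Real.zero_rpow hβ.ne', sub_zero, zero_mul, zero_sub, neg_mul, mul_assoc]
    rw [intervalIntegral.integral_neg, intervalIntegral.integral_const_mul]
    ring
  · exact ((continuous_const.sub continuous_id).rpow_const fun _ => Or.inr hβ.le).continuousOn
  · exact hFc.continuousOn
  · intro x hx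
    rw [min_eq_left ht, max_eq_right ht] at hx
    exact hasDerivAt_sub_rpow (by linarith [hx.2])
  · exact fun x _ => hF x
  · exact ((intervalIntegrable_sub_rpow (by linarith) t _ _).const_mul β).neg
  · exact hF'.intervalIntegrable _ _

lemma exists_integral_sub_rpow_mul_eq {θ : ℝ} (hθ : 0 < θ) (s : ℕ) :
    ∃ c > (0 : ℝ), ∀ F : ℝ → ℝ, Continuous F → ∀ t : ℝ, 0 ≤ t →
      ∫ y in (0 : ℝ)..t, (t - y) ^ (s + θ - 1) * F y =
        c * ∫ y in (0 : ℝ)..t, (t - y) ^ (θ - 1) * prim^[s] F y := by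
  induction s with
  | zero => exact ⟨1, one_pos, fun F _ t _ => by simp⟩
  | succ s ih =>
    obtain ⟨c, hc, h⟩ := ih
    have hβ : 0 < (s : ℝ) + θ := by positivity
    refine ⟨(s + θ) * c, by positivity, fun F hF t ht => ?_⟩
    have h1 : ((s + 1 : ℕ) : ℝ) + θ - 1 = s + θ := by push_cast; ring
    rw [h1, integral_sub_rpow_mul_deriv hβ (hasDerivAt_prim hF) hF ht, h _ (continuous_prim hF) t ht,
      prim_zero, Function.iterate_succ_apply]
    ring

lemma abs_integral_sub_rpow_mul_le_of_le {θ : ℝ} (hθ : 0 < θ) {F : ℝ → ℝ} {A c t δ : ℝ}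
    (hA : ∀ x ∈ Icc c t, |F x| ≤ A) (hA0 : 0 ≤ A) (hct : c ≤ t) (hδ : t - c ≤ δ) :
    |∫ y in c..t, (t - y) ^ (θ - 1) * F y| ≤ A * δ ^ θ / θ := by
  have h := intervalIntegral.norm_integral_le_of_norm_le (μ := volume) hct
    (f := fun y => (t - y) ^ (θ - 1) * F y) (g := fun y => A * (t - y) ^ (θ - 1))
    (ae_of_all _ fun y hy => by
      rw [norm_mul, Real.norm_eq_abs, Real.norm_eq_abs,
        abs_of_nonneg (Real.rpow_nonneg (by linarith [hy.2]) _), mul_comm]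
      gcongr
      · exact Real.rpow_nonneg (by linarith [hy.2]) _
      · exact hA y ⟨hy.1.le, hy.2⟩)
    ((intervalIntegrable_sub_rpow (by linarith) t _ _).const_mul A)
  rw [intervalIntegral.integral_const_mul, integral_sub_rpow hθ] at h
  refine h.trans ?_
  rw [mul_div_assoc]
  have : 0 ≤ t - c := by linarith
  gcongr

/-- Bound of a fractional integral by the sup norms of the integrand and of its primitive. -/
lemma abs_integral_sub_rpow_mul_le {θ : ℝ} (hθ : 0 < θ) (hθ1 : θ ≤ 1) {F : ℝ → ℝ}
    (hF : Continuous F) {A B δ : ℝ} (hA : ∀ x ∈ Icc (0 : ℝ) 1, |F x| ≤ A)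
    (hB : ∀ x ∈ Icc (0 : ℝ) 1, |prim F x| ≤ B) (hδ : 0 < δ) {t : ℝ} (ht : t ∈ Icc (0 : ℝ) 1) :
    |∫ y in (0 : ℝ)..t, (t - y) ^ (θ - 1) * F y| ≤ A * δ ^ θ / θ + 2 * B * δ ^ (θ - 1) := by
  have hA0 : 0 ≤ A := (abs_nonneg _).trans (hA t ht)
  have hB0 : 0 ≤ B := (abs_nonneg _).trans (hB t ht)
  rcases le_total t δ with h | h
  · have := abs_integral_sub_rpow_mul_le_of_le hθ
      (fun x hx => hA x ⟨hx.1, hx.2.trans ht.2⟩) hA0 ht.1 (by linarith : t - 0 ≤ δ)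
    have : 0 ≤ 2 * B * δ ^ (θ - 1) := by positivity
    linarith
  have hint : ∀ a b, IntervalIntegrable (fun y => (t - y) ^ (θ - 1) * F y) volume a b :=
    fun a b => (intervalIntegrable_sub_rpow (by linarith) t a b).mul_continuousOn hF.continuousOn
  rw [← intervalIntegral.integral_add_adjacent_intervals (hint 0 (t - δ)) (hint _ _)]
  have h1 := abs_integral_sub_rpow_mul_le_of_le hθ (c := t - δ) (δ := δ)
    (fun x hx => hA x ⟨by linarith [hx.1], hx.2.trans ht.2⟩) hA0 (by linarith) (by linarith)
  have hne : ∀ x ∈ uIcc 0 (t - δ), t - x ≠ 0 := fun x hx => by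
    rw [uIcc_of_le (by linarith)] at hx; linarith [hx.2]
  have hk' : IntervalIntegrable (fun y => -((θ - 1) * (t - y) ^ (θ - 1 - 1))) volume 0 (t - δ) := by
    refine (ContinuousOn.intervalIntegrable fun x hx => ?_)
    have := (hasDerivAt_sub_rpow (β := θ - 1 - 1) (hne x hx)).continuousAt
    exact (this.const_mul (θ - 1)).neg.continuousWithinAt
  have hkint : ∫ y in (0 : ℝ)..(t - δ), -((θ - 1) * (t - y) ^ (θ - 1 - 1)) =
      δ ^ (θ - 1) - t ^ (θ - 1) := by
    rw [intervalIntegral.integral_eq_sub_of_hasDerivAt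
      (f := fun y => (t - y) ^ (θ - 1)) (fun x hx => hasDerivAt_sub_rpow (hne x hx)) hk']
    simp
  have h2 : |∫ y in (0 : ℝ)..(t - δ), (t - y) ^ (θ - 1) * F y| ≤ 2 * B * δ ^ (θ - 1) := by
    rw [intervalIntegral.integral_mul_deriv_eq_deriv_mul
      (u := fun y => (t - y) ^ (θ - 1)) (v := prim F)
      (fun x hx => hasDerivAt_sub_rpow (hne x hx)) (fun x _ => hasDerivAt_prim hF x) hk'
      (hF.intervalIntegrable _ _)]
    have h3 := intervalIntegral.norm_integral_le_of_norm_le (μ := volume)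
      (by linarith : 0 ≤ t - δ)
      (f := fun y => -((θ - 1) * (t - y) ^ (θ - 1 - 1)) * prim F y)
      (g := fun y => B * -((θ - 1) * (t - y) ^ (θ - 1 - 1)))
      (ae_of_all _ fun y hy => by
        have hy2 : 0 ≤ t - y := by linarith [hy.2]
        have h0 : 0 ≤ -((θ - 1) * (t - y) ^ (θ - 1 - 1)) := by
          rw [← neg_mul]
          exact mul_nonneg (by linarith) (Real.rpow_nonneg hy2 _)
        rw [norm_mul, Real.norm_eq_abs, Real.norm_eq_abs, abs_of_nonneg h0, mul_comm]
        gcongr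
        exact hB y ⟨hy.1.le, by linarith [hy.2, ht.2]⟩)
      (hk'.const_mul B)
    rw [intervalIntegral.integral_const_mul, hkint, Real.norm_eq_abs] at h3
    rw [prim_zero, mul_zero, sub_zero, sub_sub_cancel]
    refine (abs_sub _ _).trans ?_
    rw [abs_mul, abs_of_nonneg (by positivity : 0 ≤ δ ^ (θ - 1))]
    have h4 := hB (t - δ) ⟨by linarith, by linarith [ht.2]⟩
    have h5 : 0 ≤ t ^ (θ - 1) := Real.rpow_nonneg ht.1 _
    have h6 : 0 ≤ δ ^ (θ - 1) := by positivity
    nlinarith [mul_nonneg h6 (sub_nonneg.2 h4), mul_nonneg hB0 h5]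
  have := abs_add_le (∫ y in (0 : ℝ)..(t - δ), (t - y) ^ (θ - 1) * F y)
    (∫ y in (t - δ)..t, (t - y) ^ (θ - 1) * F y)
  linarith

/-- Fractional integrals of functions orthogonal to polynomials of low degree are small. -/
lemma exists_abs_integral_sub_rpow_mul_le {θ : ℝ} (hθ : 0 < θ) (hθ1 : θ ≤ 1) {s : ℕ}
    (hs : 1 ≤ s) :
    ∃ C > (0 : ℝ), ∀ p : ℕ, s ≤ p → ∀ r : ℝ → ℝ, Continuous r → (∀ n < p, legCoeff r n = 0) →
      ∀ t ∈ Icc (0 : ℝ) 1, |∫ y in (0 : ℝ)..t, (t - y) ^ (s + θ - 1) * r y| ≤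
        C * (p : ℝ) ^ (-(s + θ - 1 / 2)) * √(normSq r) := by
  obtain ⟨c, hc, hrep⟩ := exists_integral_sub_rpow_mul_eq hθ s
  set D : ℝ := √2 * (s + 1).factorial with hD
  have hD0 : 0 < D := by positivity
  refine ⟨c * D * (1 / θ + 2), by positivity, fun p hp r hr h t ht => ?_⟩
  have hp0 : (0 : ℝ) < p := by exact_mod_cast (by lia : 0 < p)
  set M := √(normSq r) with hM
  have hM0 : 0 ≤ M := Real.sqrt_nonneg _
  have hM2 : M ^ 2 = normSq r := Real.sq_sqrt (normSq_nonneg r)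
  have hbd : ∀ (X f : ℝ) (e : ℕ), 0 ≤ f → f ≤ (s + 1).factorial →
      X ^ 2 ≤ 2 * f ^ 2 / (p : ℝ) ^ e * normSq r → |X| ≤ D * (p : ℝ) ^ (-((e : ℝ) / 2)) * M := by
    intro X f e hf0 hf hX
    have e1 : ((p : ℝ) ^ (-((e : ℝ) / 2))) ^ 2 = 1 / (p : ℝ) ^ e := by
      rw [← Real.rpow_natCast (_ ^ _) 2, ← Real.rpow_mul hp0.le, Nat.cast_ofNat,
        show -((e : ℝ) / 2) * 2 = -(e : ℝ) by ring, Real.rpow_neg hp0.le, Real.rpow_natCast,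
        one_div]
    refine abs_le_of_sq_le_sq (hX.trans ?_) (by positivity)
    rw [mul_pow, mul_pow, e1, hM2, hD, mul_pow, Real.sq_sqrt zero_le_two, mul_one_div]
    have := normSq_nonneg r
    gcongr
  have hA : ∀ x ∈ Icc (0 : ℝ) 1, |prim^[s] r x| ≤ D * (p : ℝ) ^ (-((s : ℝ) - 1 / 2)) * M := by
    intro x hx
    have h1 := sq_iterate_prim_le_aux hr h (s - 1) (by lia) hx
    rw [Nat.sub_add_cancel hs] at h1
    have := hbd _ _ _ (by positivity)
      (by exact_mod_cast Nat.factorial_le (Nat.le_succ s)) h1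
    convert this using 4
    have : ((2 * (s - 1) + 1 : ℕ) : ℝ) = 2 * s - 1 := by
      push_cast [Nat.cast_sub hs]; ring
    rw [this]; ring
  have hB : ∀ x ∈ Icc (0 : ℝ) 1,
      |prim (prim^[s] r) x| ≤ D * (p : ℝ) ^ (-((s : ℝ) + 1 / 2)) * M := by
    intro x hx
    have h1 := sq_iterate_prim_le hr h s hp hs hx
    rw [Function.iterate_succ_apply'] at h1
    have := hbd _ _ _ (by positivity) le_rfl h1
    convert this using 4
    push_cast; ring
  have hkey := abs_integral_sub_rpow_mul_le hθ hθ1 (continuous_iterate_prim hr s) hA hB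
    (inv_pos.2 hp0) ht
  rw [hrep r hr t ht.1, abs_mul, abs_of_pos hc]
  calc _ ≤ c * _ := mul_le_mul_of_nonneg_left hkey hc.le
    _ = _ := by
      rw [Real.inv_rpow hp0.le, Real.inv_rpow hp0.le, ← Real.rpow_neg hp0.le,
        ← Real.rpow_neg hp0.le]
      have e1 : (p : ℝ) ^ (-((s : ℝ) + θ - 1 / 2)) =
          (p : ℝ) ^ (-((s : ℝ) - 1 / 2)) * (p : ℝ) ^ (-θ) := by
        rw [← Real.rpow_add hp0]; congr 1; ring
      have e2 : (p : ℝ) ^ (-((s : ℝ) + θ - 1 / 2)) =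
          (p : ℝ) ^ (-((s : ℝ) + 1 / 2)) * (p : ℝ) ^ (-(θ - 1)) := by
        rw [← Real.rpow_add hp0]; congr 1; ring
      calc _ = c * D * M * (((p : ℝ) ^ (-((s : ℝ) - 1 / 2)) * (p : ℝ) ^ (-θ)) / θ +
            2 * ((p : ℝ) ^ (-((s : ℝ) + 1 / 2)) * (p : ℝ) ^ (-(θ - 1)))) := by ring
        _ = _ := by rw [← e1, ← e2]; ring

lemma exists_abs_integral_sub_rpow_mul_leg_le {θ : ℝ} (hθ : 0 < θ) (hθ1 : θ ≤ 1) (s : ℕ) :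
    ∃ C > (0 : ℝ), ∀ p n : ℕ, 0 < p → p ≤ n + 1 → ∀ t ∈ Icc (0 : ℝ) 1,
      |∫ y in (0 : ℝ)..t, (t - y) ^ (s + θ - 1) * (leg n).eval y| ≤ C * (p : ℝ) ^ (-(s + θ)) := by
  obtain ⟨c, hc, hrep⟩ := exists_integral_sub_rpow_mul_eq hθ s
  obtain ⟨C₁, hC₁, h₁⟩ := exists_abs_iterate_prim_leg_le s
  obtain ⟨C₂, hC₂, h₂⟩ := exists_abs_iterate_prim_leg_le (s + 1)
  refine ⟨c * (C₁ / θ + 2 * C₂), by positivity, fun p n hp hpn t ht => ?_⟩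
  have hp0 : (0 : ℝ) < p := by exact_mod_cast hp
  have hpn' : (p : ℝ) ≤ n + 1 := by exact_mod_cast hpn
  have hA : ∀ x ∈ Icc (0 : ℝ) 1, |prim^[s] (fun y => (leg n).eval y) x| ≤
      C₁ * (p : ℝ) ^ (-(s : ℝ)) := fun x hx => by
    refine (h₁ n x hx).trans ?_
    rw [Real.rpow_neg hp0.le, Real.rpow_natCast, ← div_eq_mul_inv]
    gcongr
  have hB : ∀ x ∈ Icc (0 : ℝ) 1, |prim (prim^[s] fun y => (leg n).eval y) x| ≤
      C₂ * (p : ℝ) ^ (-((s : ℝ) + 1)) := fun x hx => by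
    have := h₂ n x hx
    rw [Function.iterate_succ_apply'] at this
    refine this.trans ?_
    rw [Real.rpow_neg hp0.le, ← Nat.cast_add_one s, Real.rpow_natCast, ← div_eq_mul_inv]
    gcongr
  have hkey := abs_integral_sub_rpow_mul_le hθ hθ1 (continuous_iterate_prim (continuous_leg n) s)
    hA hB (inv_pos.2 hp0) ht
  rw [hrep _ (continuous_leg n) t ht.1, abs_mul, abs_of_pos hc]
  calc _ ≤ c * _ := mul_le_mul_of_nonneg_left hkey hc.le
    _ = _ := by
      rw [Real.inv_rpow hp0.le, Real.inv_rpow hp0.le, ← Real.rpow_neg hp0.le,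
        ← Real.rpow_neg hp0.le]
      have e1 : (p : ℝ) ^ (-((s : ℝ) + θ)) = (p : ℝ) ^ (-(s : ℝ)) * (p : ℝ) ^ (-θ) := by
        rw [← Real.rpow_add hp0]; congr 1; ring
      have e2 : (p : ℝ) ^ (-((s : ℝ) + θ)) =
          (p : ℝ) ^ (-((s : ℝ) + 1)) * (p : ℝ) ^ (-(θ - 1)) := by
        rw [← Real.rpow_add hp0]; congr 1; ring
      calc _ = c * (C₁ * ((p : ℝ) ^ (-(s : ℝ)) * (p : ℝ) ^ (-θ)) / θ +
            2 * C₂ * ((p : ℝ) ^ (-((s : ℝ) + 1)) * (p : ℝ) ^ (-(θ - 1)))) := by ring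
        _ = _ := by rw [← e1, ← e2]; ring

lemma sum_leg_eval {p : ℕ} (hp : 0 < p) (x : ℝ) :
    ∑ n ∈ Finset.range p, (2 * (n : ℝ) + 1) * (leg n).eval x =
      -(1 / 2) * (dleg p x + dleg (p - 1) x) := by
  induction p, hp using Nat.le_induction with
  | base =>
    have := dleg_pred_sub_dleg_succ 0 x
    simp only [Nat.zero_sub, zero_add, Nat.cast_zero] at this
    have h0 : dleg 0 x = 0 := by simp [dleg, leg_zero]
    rw [h0] at this
    simp [h0]
    linarith
  | succ p hp ih =>
    rw [Finset.sum_range_succ, ih]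
    have := dleg_pred_sub_dleg_succ p x
    simp only [Nat.add_sub_cancel]
    linarith

/-- The endpoint functional applied to a truncated power. -/
lemma rpow_sub_sum_integral {σ : ℝ} (hσ : 0 < σ) {p : ℕ} (hp : 0 < p) {t : ℝ} (ht : 0 ≤ t) :
    t ^ σ - ∑ n ∈ Finset.range p, (2 * (n : ℝ) + 1) *
        ∫ y in (0 : ℝ)..t, (t - y) ^ σ * (leg n).eval y =
      σ / 2 * ((∫ y in (0 : ℝ)..t, (t - y) ^ (σ - 1) * (leg p).eval y) +
        ∫ y in (0 : ℝ)..t, (t - y) ^ (σ - 1) * (leg (p - 1)).eval y) := by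
  have hi : ∀ n, IntervalIntegrable (fun y => (t - y) ^ σ * (leg n).eval y) volume 0 t := fun n =>
    (intervalIntegrable_sub_rpow (by linarith) t 0 t).mul_continuousOn (continuous_leg n).continuousOn
  have hd : ∀ n, IntervalIntegrable (fun y => (t - y) ^ σ * dleg n y) volume 0 t := fun n =>
    (intervalIntegrable_sub_rpow (by linarith) t 0 t).mul_continuousOn
      (continuous_dleg n).continuousOn
  have h1 : ∑ n ∈ Finset.range p, (2 * (n : ℝ) + 1) *
      ∫ y in (0 : ℝ)..t, (t - y) ^ σ * (leg n).eval y =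
      -(1 / 2) * ((∫ y in (0 : ℝ)..t, (t - y) ^ σ * dleg p y) +
        ∫ y in (0 : ℝ)..t, (t - y) ^ σ * dleg (p - 1) y) := by
    simp_rw [← intervalIntegral.integral_const_mul]
    rw [← intervalIntegral.integral_add (hd _) (hd _), ← intervalIntegral.integral_const_mul,
      ← intervalIntegral.integral_finsetSum fun n _ => (hi n).const_mul _]
    congr 1; funext y
    rw [← mul_add, mul_left_comm, ← sum_leg_eval hp, Finset.mul_sum]
    exact Finset.sum_congr rfl fun n _ => by ring
  rw [h1, integral_sub_rpow_mul_deriv hσ (hasDerivAt_leg p) (continuous_dleg p) ht,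
    integral_sub_rpow_mul_deriv hσ (hasDerivAt_leg (p - 1)) (continuous_dleg _) ht,
    leg_eval_zero, leg_eval_zero]
  ring

/-- The truncated power `t ↦ t₊^σ`. -/
noncomputable def posPow (σ t : ℝ) : ℝ := (max t 0) ^ σ

lemma continuous_posPow {σ : ℝ} (hσ : 0 < σ) : Continuous (posPow σ) :=
  (continuous_id.max continuous_const).rpow_const fun _ => Or.inr hσ.le

lemma posPow_of_nonneg {σ t : ℝ} (ht : 0 ≤ t) : posPow σ t = t ^ σ := by
  rw [posPow, max_eq_left ht]

lemma posPow_of_nonpos {σ t : ℝ} (hσ : 0 < σ) (ht : t ≤ 0) : posPow σ t = 0 := by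
  rw [posPow, max_eq_right ht, Real.zero_rpow hσ.ne']

lemma posPow_nonneg (σ t : ℝ) : 0 ≤ posPow σ t := Real.rpow_nonneg (le_max_right _ _) _

lemma posPow_le_one {σ t : ℝ} (hσ : 0 < σ) (ht : t ≤ 1) : posPow σ t ≤ 1 :=
  Real.rpow_le_one (le_max_right _ _) (max_le ht zero_le_one) hσ.le

lemma intervalIntegrable_posPow_mul {σ : ℝ} (hσ : 0 < σ) {ω : ℝ → ℝ} {a b : ℝ}
    (hω : IntervalIntegrable ω volume a b) (y : ℝ) :
    IntervalIntegrable (fun τ => posPow σ (τ - y) * ω τ) volume a b :=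
  hω.continuousOn_mul ((continuous_posPow hσ).comp (by fun_prop)).continuousOn

lemma integral_posPow_right {σ : ℝ} (hσ : 0 < σ) {ω : ℝ → ℝ}
    (hω : IntervalIntegrable ω volume 0 1) {y : ℝ} (hy : y ∈ Icc (0 : ℝ) 1) :
    ∫ τ in (0 : ℝ)..1, posPow σ (τ - y) * ω τ = ∫ τ in y..1, (τ - y) ^ σ * ω τ := by
  have hu : ∀ {a b : ℝ}, a ∈ Icc (0 : ℝ) 1 → b ∈ Icc (0 : ℝ) 1 →
      IntervalIntegrable (fun τ => posPow σ (τ - y) * ω τ) volume a b := fun ha hb =>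
    (intervalIntegrable_posPow_mul hσ hω y).mono_set (by
      rw [uIcc_of_le zero_le_one]; exact uIcc_subset_Icc ha hb)
  rw [← intervalIntegral.integral_add_adjacent_intervals
    (hu (left_mem_Icc.2 zero_le_one) hy) (hu hy (right_mem_Icc.2 zero_le_one))]
  have h1 : ∫ τ in (0 : ℝ)..y, posPow σ (τ - y) * ω τ = ∫ τ in (0 : ℝ)..y, (0 : ℝ) := by
    refine intervalIntegral.integral_congr fun τ hτ => ?_
    rw [uIcc_of_le hy.1] at hτ
    simp only [posPow_of_nonpos hσ (by linarith [hτ.2] : τ - y ≤ 0), zero_mul]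
  rw [h1, intervalIntegral.integral_zero, zero_add]
  refine intervalIntegral.integral_congr fun τ hτ => ?_
  rw [uIcc_of_le hy.2] at hτ
  simp only [posPow_of_nonneg (by linarith [hτ.1] : 0 ≤ τ - y)]

lemma integral_posPow_left {σ : ℝ} (hσ : 0 < σ) {g : ℝ → ℝ} (hg : Continuous g) {t : ℝ}
    (ht : t ∈ Icc (0 : ℝ) 1) :
    ∫ y in (0 : ℝ)..1, posPow σ (t - y) * g y = ∫ y in (0 : ℝ)..t, (t - y) ^ σ * g y := by
  have hu : ∀ a b : ℝ, IntervalIntegrable (fun y => posPow σ (t - y) * g y) volume a b :=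
    fun a b => (((continuous_posPow hσ).comp (by fun_prop : Continuous fun y => t - y)).mul
      hg).intervalIntegrable _ _
  rw [← intervalIntegral.integral_add_adjacent_intervals (hu 0 t) (hu t 1)]
  have h1 : ∫ y in t..1, posPow σ (t - y) * g y = ∫ y in t..1, (0 : ℝ) := by
    refine intervalIntegral.integral_congr fun y hy => ?_
    rw [uIcc_of_le ht.2] at hy
    simp only [posPow_of_nonpos hσ (by linarith [hy.1] : t - y ≤ 0), zero_mul]
  rw [h1, intervalIntegral.integral_zero, add_zero]
  refine intervalIntegral.integral_congr fun y hy => ?_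
  rw [uIcc_of_le ht.1] at hy
  simp only [posPow_of_nonneg (by linarith [hy.2] : 0 ≤ t - y)]

lemma continuous_integral_posPow {σ : ℝ} (hσ : 0 < σ) {g : ℝ → ℝ} (hg : Continuous g) :
    Continuous fun t => ∫ y in (0 : ℝ)..1, posPow σ (t - y) * g y := by
  apply intervalIntegral.continuous_parametric_intervalIntegral_of_continuous'
  have := continuous_posPow hσ
  fun_prop

lemma integrable_posPow_mul {σ : ℝ} (hσ : 0 < σ) {ω g : ℝ → ℝ}
    (hω : IntervalIntegrable ω volume 0 1) (hg : Continuous g) :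
    Integrable (fun z : ℝ × ℝ => posPow σ (z.2 - z.1) * (g z.1 * ω z.2))
      ((volume.restrict (Ioc 0 1)).prod (volume.restrict (Ioc 0 1))) := by
  have h1 : Integrable g (volume.restrict (Ioc (0 : ℝ) 1)) :=
    (intervalIntegrable_iff_integrableOn_Ioc_of_le zero_le_one).1 (hg.intervalIntegrable _ _)
  have h2 : Integrable ω (volume.restrict (Ioc (0 : ℝ) 1)) :=
    (intervalIntegrable_iff_integrableOn_Ioc_of_le zero_le_one).1 hω
  have := continuous_posPow hσ
  refine (h1.mul_prod h2).bdd_mul (c := 1)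
    (by fun_prop : Continuous fun z : ℝ × ℝ => posPow σ (z.2 - z.1)).aestronglyMeasurable ?_
  rw [Measure.prod_restrict]
  filter_upwards [ae_restrict_mem (measurableSet_Ioc.prod measurableSet_Ioc)] with z hz
  rw [Real.norm_eq_abs, abs_of_nonneg (posPow_nonneg _ _)]
  exact posPow_le_one hσ (by linarith [hz.2.2, hz.1.1])

lemma integral_posPow_swap {σ : ℝ} (hσ : 0 < σ) {ω g : ℝ → ℝ}
    (hω : IntervalIntegrable ω volume 0 1) (hg : Continuous g) :
    ∫ y in (0 : ℝ)..1, (∫ τ in (0 : ℝ)..1, posPow σ (τ - y) * ω τ) * g y =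
      ∫ τ in (0 : ℝ)..1, ω τ * ∫ y in (0 : ℝ)..1, posPow σ (τ - y) * g y := by
  have := integral_integral_swap (f := fun y τ => posPow σ (τ - y) * (g y * ω τ))
    (integrable_posPow_mul hσ hω hg)
  simp only [← intervalIntegral.integral_of_le (zero_le_one' ℝ)] at this
  convert this using 1
  · congr 1; funext y
    rw [← intervalIntegral.integral_mul_const]
    congr 1; funext τ; ring
  · congr 1; funext τ
    rw [← intervalIntegral.integral_const_mul]
    congr 1; funext y; ring

lemma intervalIntegrable_integral_posPow_mul {σ : ℝ} (hσ : 0 < σ) {ω g : ℝ → ℝ}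
    (hω : IntervalIntegrable ω volume 0 1) (hg : Continuous g) :
    IntervalIntegrable (fun y => (∫ τ in (0 : ℝ)..1, posPow σ (τ - y) * ω τ) * g y)
      volume 0 1 := by
  rw [intervalIntegrable_iff_integrableOn_Ioc_of_le zero_le_one]
  have := (integrable_posPow_mul hσ hω hg).integral_prod_left
  refine this.congr (ae_of_all _ fun y => ?_)
  simp only [← intervalIntegral.integral_of_le (zero_le_one' ℝ)]
  rw [← intervalIntegral.integral_mul_const]
  congr 1; funext τ; ring

/-- A polynomial of degree less than `N` equals its projection. -/
lemma eval_legProj_of_natDegree_lt {N : ℕ} {q : Polynomial ℝ} (hq : q.natDegree < N) {y : ℝ}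
    (hy : y ∈ Icc (0 : ℝ) 1) : (legProj (fun x => q.eval x) N).eval y = q.eval y := by
  set d := q - legProj (fun x => q.eval x) N with hd
  have hdd : d.natDegree < N := (Polynomial.natDegree_sub_le _ _).trans_lt
    (max_lt hq (natDegree_legProj_lt (by lia)))
  have h0 : ∫ x in (0 : ℝ)..1, d.eval x * d.eval x = 0 := by
    have := integral_sub_legProj_mul q.continuous hdd
    simpa [hd] using this
  by_contra hne
  have : 0 < ∫ x in (0 : ℝ)..1, d.eval x * d.eval x := by
    refine intervalIntegral.integral_pos zero_lt_one (by fun_prop)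
      (fun x _ => mul_self_nonneg _) ⟨y, hy, mul_self_pos.2 ?_⟩
    rw [hd, Polynomial.eval_sub]
    exact sub_ne_zero.2 (Ne.symm hne)
  exact (ne_of_gt this) h0

/-- A polynomial of degree at most `p` orthogonal to polynomials of lower degree is a multiple of
the Legendre polynomial. -/
lemma eval_eq_mul_leg {p : ℕ} {d : Polynomial ℝ} (hd : d.natDegree ≤ p)
    (h : ∀ n < p, legCoeff (fun x => d.eval x) n = 0) {y : ℝ} (hy : y ∈ Icc (0 : ℝ) 1) :
    d.eval y = d.eval 0 * (leg p).eval y := by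
  have key : ∀ z ∈ Icc (0 : ℝ) 1, d.eval z =
      (2 * p + 1) * legCoeff (fun x => d.eval x) p * (leg p).eval z := fun z hz => by
    rw [← eval_legProj_of_natDegree_lt (Nat.lt_succ_of_le hd) hz, legProj_eval,
      Finset.sum_range_succ, Finset.sum_eq_zero, zero_add]
    intro n hn
    rw [h n (Finset.mem_range.1 hn), mul_zero, zero_mul]
  rw [key y hy, key 0 (by simp), leg_eval_zero, mul_one]

/-- Functions given by their fractional Taylor expansion at `1`. -/
def HasFracTaylor (m : ℕ) (α : ℝ) (v : ℝ → ℝ) (q : Polynomial ℝ) (l : ℕ → ℝ) (ω : ℝ → ℝ) : Prop :=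
  ∀ y ∈ Icc (0 : ℝ) 1, v y = q.eval y + ∑ i ∈ Finset.range m, l i * (1 - y) ^ (α + i) +
    ∫ τ in y..1, (τ - y) ^ (α + m - 1) * ω τ

lemma HasFracTaylor.integral_mul {m : ℕ} {α : ℝ} {v : ℝ → ℝ} {q : Polynomial ℝ} {l : ℕ → ℝ}
    {ω : ℝ → ℝ} (hv : HasFracTaylor m α v q l ω) (hα : 0 ≤ α) (hσ : 0 < α + m - 1)
    (hω : IntervalIntegrable ω volume 0 1) {g : ℝ → ℝ} (hg : Continuous g) :
    ∫ y in (0 : ℝ)..1, v y * g y = (∫ y in (0 : ℝ)..1, q.eval y * g y) +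
      ∑ i ∈ Finset.range m, l i * (∫ y in (0 : ℝ)..1, (1 - y) ^ (α + i) * g y) +
      ∫ τ in (0 : ℝ)..1, ω τ * ∫ y in (0 : ℝ)..1, posPow (α + m - 1) (τ - y) * g y := by
  have hq := q.continuous
  have hp : ∀ i : ℕ, Continuous fun y : ℝ => l i * ((1 - y) ^ (α + i) * g y) := fun i =>
    continuous_const.mul ((continuous_one_sub_rpow (by positivity)).mul hg)
  rw [← integral_posPow_swap hσ hω hg]
  simp_rw [← intervalIntegral.integral_const_mul]
  rw [← intervalIntegral.integral_finsetSum fun i _ => (hp i).intervalIntegrable _ _,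
    ← intervalIntegral.integral_add, ← intervalIntegral.integral_add]
  · refine intervalIntegral.integral_congr fun y hy => ?_
    rw [uIcc_of_le zero_le_one] at hy
    rw [hv y hy, integral_posPow_right hσ hω hy, add_mul, add_mul, Finset.sum_mul]
    simp_rw [mul_assoc]
  · exact Continuous.intervalIntegrable
      ((hq.mul hg).add (continuous_finsetSum _ fun i _ => hp i)) _ _
  · exact intervalIntegrable_integral_posPow_mul hσ hω hg
  · exact (hq.mul hg).intervalIntegrable _ _
  · exact Continuous.intervalIntegrable (continuous_finsetSum _ fun i _ => hp i) _ _

lemma abs_integral_mul_le {ω G : ℝ → ℝ} {A : ℝ} (hω : IntervalIntegrable ω volume 0 1)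
    (hG : ∀ t ∈ Icc (0 : ℝ) 1, |G t| ≤ A) :
    |∫ t in (0 : ℝ)..1, ω t * G t| ≤ A * ∫ t in (0 : ℝ)..1, |ω t| := by
  rw [← intervalIntegral.integral_const_mul]
  refine intervalIntegral.norm_integral_le_of_norm_le (f := fun t => ω t * G t) zero_le_one
    (ae_of_all _ fun t ht => ?_) (hω.abs.const_mul A)
  rw [norm_mul, Real.norm_eq_abs, Real.norm_eq_abs, mul_comm]
  exact mul_le_mul_of_nonneg_right (hG t ⟨ht.1.le, ht.2⟩) (abs_nonneg _)

/-- The value at `0` of the projection error, in terms of the fractional Taylor expansion. -/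
lemma HasFracTaylor.sub_legProj_zero {m : ℕ} {α : ℝ} {v : ℝ → ℝ} {q : Polynomial ℝ} {l : ℕ → ℝ}
    {ω : ℝ → ℝ} (hv : HasFracTaylor m α v q l ω) (hα : 0 ≤ α) (hσ : 0 < α + m - 1)
    (hω : IntervalIntegrable ω volume 0 1) {p : ℕ} (hq : q.natDegree < p) :
    v 0 - (legProj v p).eval 0 =
      ∑ i ∈ Finset.range m,
        l i * (1 - ∑ n ∈ Finset.range p, (2 * n + 1) * legMoment (α + i) n) +
      ∫ τ in (0 : ℝ)..1, ω τ * (posPow (α + m - 1) τ - ∑ n ∈ Finset.range p, (2 * (n : ℝ) + 1) *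
        ∫ y in (0 : ℝ)..1, posPow (α + m - 1) (τ - y) * (leg n).eval y) := by
  have h0 := hv 0 (by simp)
  have hq0 := eval_legProj_of_natDegree_lt hq (y := 0) (by simp)
  rw [← integral_posPow_right hσ hω (by simp)] at h0
  have hA : ∀ n, Continuous fun τ : ℝ =>
      ∫ y in (0 : ℝ)..1, posPow (α + m - 1) (τ - y) * (leg n).eval y :=
    fun n => continuous_integral_posPow hσ (continuous_leg n)
  have hcoef : ∀ n, legCoeff v n = legCoeff (fun x => q.eval x) n +
      ∑ i ∈ Finset.range m, l i * legMoment (α + i) n +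
      ∫ τ in (0 : ℝ)..1, ω τ *
        ∫ y in (0 : ℝ)..1, posPow (α + m - 1) (τ - y) * (leg n).eval y :=
    fun n => hv.integral_mul hα hσ hω (continuous_leg n)
  simp only [sub_zero, Real.one_rpow, mul_one] at h0
  rw [legProj_eval] at hq0 ⊢
  simp only [leg_eval_zero, mul_one] at hq0 ⊢
  have hsum : ∑ n ∈ Finset.range p, (2 * (n : ℝ) + 1) * legCoeff v n =
      q.eval 0 + ∑ i ∈ Finset.range m,
        l i * ∑ n ∈ Finset.range p, (2 * n + 1) * legMoment (α + i) n +
      ∫ τ in (0 : ℝ)..1, ω τ * ∑ n ∈ Finset.range p, (2 * (n : ℝ) + 1) *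
        ∫ y in (0 : ℝ)..1, posPow (α + m - 1) (τ - y) * (leg n).eval y := by
    simp_rw [hcoef, mul_add, Finset.sum_add_distrib]
    rw [hq0]
    congr 1
    · congr 1
      simp_rw [Finset.mul_sum]
      rw [Finset.sum_comm]
      exact Finset.sum_congr rfl fun i _ => Finset.sum_congr rfl fun n _ => by ring
    · simp_rw [Finset.mul_sum]
      rw [intervalIntegral.integral_finsetSum]
      · refine Finset.sum_congr rfl fun n _ => ?_
        rw [← intervalIntegral.integral_const_mul]
        congr 1; funext τ; ring
      · exact fun n _ => hω.mul_continuousOn (continuous_const.mul (hA n)).continuousOn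
  rw [h0, hsum]
  simp_rw [mul_sub, mul_one, Finset.sum_sub_distrib]
  rw [intervalIntegral.integral_sub]
  · simp_rw [mul_comm (posPow _ _)]
    ring
  · exact hω.mul_continuousOn (continuous_posPow hσ).continuousOn
  · exact hω.mul_continuousOn (continuous_finsetSum _ fun n _ =>
      continuous_const.mul (hA n)).continuousOn

lemma normSq_sub_le {f g : ℝ → ℝ} (hf : Continuous f) (hg : Continuous g) :
    normSq (fun x => f x - g x) ≤ 2 * normSq f + 2 * normSq g := by
  rw [normSq, normSq, normSq, ← intervalIntegral.integral_const_mul,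
    ← intervalIntegral.integral_const_mul, ← intervalIntegral.integral_add]
  · refine intervalIntegral.integral_mono_on zero_le_one ?_ ?_ fun x _ => ?_
    · exact Continuous.intervalIntegrable (by fun_prop) _ _
    · exact Continuous.intervalIntegrable (by fun_prop) _ _
    · nlinarith [sq_nonneg (f x + g x)]
  all_goals exact Continuous.intervalIntegrable (by fun_prop) _ _

lemma abs_sum_mul_le {m : ℕ} {l x c : ℕ → ℝ} {w : ℝ} (hc : ∀ i, 0 ≤ c i)
    (hw : 0 ≤ w) (hx : ∀ i, |x i| ≤ c i * w) :
    |∑ i ∈ Finset.range m, l i * x i| ≤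
      (∑ i ∈ Finset.range m, c i) * w * ∑ i ∈ Finset.range m, |l i| := by
  refine (Finset.abs_sum_le_sum_abs _ _).trans ?_
  rw [Finset.mul_sum]
  refine Finset.sum_le_sum fun i hi => ?_
  rw [abs_mul, mul_comm]
  refine mul_le_mul_of_nonneg_right ((hx i).trans ?_) (abs_nonneg _)
  exact mul_le_mul_of_nonneg_right (Finset.single_le_sum (fun j _ => hc j) hi) hw

set_option maxHeartbeats 1000000 in
/-- Gauss–Radau projection error on the unit interval, with the singularity at `1` and the
interpolation condition at `0`. -/
lemma exists_radau_error_le {k m : ℕ} (hk : 1 ≤ k) (hm : 1 ≤ m) {α : ℝ}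
    (hα1 : (k : ℝ) - 1 < α) (hα2 : α < (k : ℝ)) :
    ∃ C > (0 : ℝ), ∀ p : ℕ, k + m ≤ p + 1 → ∀ (v : ℝ → ℝ) (q : Polynomial ℝ) (l : ℕ → ℝ)
      (ω : ℝ → ℝ), Continuous v → IntervalIntegrable ω volume 0 1 → q.natDegree < k →
      HasFracTaylor m α v q l ω → ∀ P : Polynomial ℝ, P.natDegree ≤ p →
      (∀ n < p, ∫ y in (0 : ℝ)..1, (P.eval y - v y) * (leg n).eval y = 0) →
      P.eval 0 = v 0 →
      √(normSq fun y => v y - P.eval y) ≤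
        C * (p : ℝ) ^ (-(min (2 * α + 1) (α + (m : ℝ) - 1 / 2))) *
          (∑ i ∈ Finset.range m, |l i| + ∫ t in (0 : ℝ)..1, |ω t|) := by
  obtain ⟨j, rfl⟩ : ∃ j, k = j + 1 := ⟨k - 1, by lia⟩
  obtain ⟨e, rfl⟩ : ∃ e, m = e + 1 := ⟨m - 1, by lia⟩
  rw [Nat.cast_add_one, add_sub_cancel_right] at hα1
  rw [Nat.cast_add_one] at hα2
  have hα0 : 0 ≤ α := (Nat.cast_nonneg j).trans hα1.le
  set θ : ℝ := α - j with hθ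
  have hθ0 : 0 < θ := by linarith
  have hθ1 : θ ≤ 1 := by linarith
  have hσ : 0 < α + ((e + 1 : ℕ) : ℝ) - 1 := by
    have := Nat.cast_nonneg (α := ℝ) j
    have := Nat.cast_nonneg (α := ℝ) e
    push_cast; linarith
  choose c₁ hc₁ h₁ using fun i : ℕ =>
    exists_abs_integral_one_sub_rpow_mul_le (β := α + i) (by positivity)
  obtain ⟨C₂, hC₂, h₂⟩ :=
    exists_abs_integral_sub_rpow_mul_le hθ0 hθ1 (s := j + e + 1) (by lia)
  obtain ⟨C₃, hC₃, h₃⟩ := exists_abs_integral_sub_rpow_mul_leg_le hθ0 hθ1 (j + e)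
  set σ : ℝ := α + ((e + 1 : ℕ) : ℝ) - 1 with hσd
  have hσ2 : ((j + e + 1 : ℕ) : ℝ) + θ - 1 = σ := by rw [hσd, hθ]; push_cast; ring
  have hσ3 : ((j + e : ℕ) : ℝ) + θ = σ := by rw [hσd, hθ]; push_cast; ring
  rw [hσ2] at h₂
  rw [hσ3] at h₃
  set C₁ := ∑ i ∈ Finset.range (e + 1), c₁ i with hC₁d
  have hC₁ : 0 ≤ C₁ := Finset.sum_nonneg fun i _ => (hc₁ i).le
  refine ⟨2 * (C₁ + C₂) + 2 * (C₁ + σ * C₃), by positivity, ?_⟩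
  intro p hp v q l ω hv hω hq hT P hP hPo hP0
  have hpn : 0 < p := by lia
  have hp0 : (0 : ℝ) < p := by exact_mod_cast hpn
  have hp1 : (1 : ℝ) ≤ p := by exact_mod_cast hpn
  set μ := min (2 * α + 1) (α + ((e + 1 : ℕ) : ℝ) - 1 / 2) with hμ
  set w : ℝ := (p : ℝ) ^ (-μ) with hw
  have hw0 : 0 < w := by positivity
  set S := ∑ i ∈ Finset.range (e + 1), |l i| with hS
  set W := ∫ t in (0 : ℝ)..1, |ω t| with hW
  have hS0 : 0 ≤ S := Finset.sum_nonneg fun i _ => abs_nonneg _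
  have hW0 : 0 ≤ W := intervalIntegral.integral_nonneg zero_le_one fun _ _ => abs_nonneg _
  have hwi : ∀ i : ℕ, (p : ℝ) ^ (-(2 * (α + i) + 1)) ≤ w := fun i => by
    refine Real.rpow_le_rpow_of_exponent_le hp1 ?_
    have := min_le_left (2 * α + 1) (α + ((e + 1 : ℕ) : ℝ) - 1 / 2)
    have := Nat.cast_nonneg (α := ℝ) i
    rw [← hμ] at *
    linarith
  have hμ2 : μ ≤ σ + 1 / 2 := (min_le_right _ _).trans (by rw [hσd]; linarith)
  set r : ℝ → ℝ := fun y => v y - (legProj v p).eval y with hr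
  have hrc : Continuous r := hv.sub (Polynomial.continuous _)
  have hr0 : ∀ n < p, legCoeff r n = 0 := fun n hn => by
    rw [hr, legCoeff_sub_legProj hv, if_pos hn]
  have hqr : ∫ y in (0 : ℝ)..1, q.eval y * r y = 0 := by
    have := integral_mul_eval_eq_zero hrc hr0 (v := q) (by lia)
    simpa only [mul_comm] using this
  set M := √(normSq r) with hM
  have hM0 : 0 ≤ M := Real.sqrt_nonneg _
  have hMsq : M ^ 2 = ∫ y in (0 : ℝ)..1, v y * r y := by
    have h0 := integral_mul_eval_eq_zero hrc hr0 (natDegree_legProj_lt (f := v) hpn)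
    rw [hM, Real.sq_sqrt (normSq_nonneg r), normSq, ← sub_eq_zero,
      ← intervalIntegral.integral_sub, ← neg_eq_zero, ← intervalIntegral.integral_neg, ← h0]
    · congr 1; funext y; rw [hr]; ring
    · exact (hrc.pow 2).intervalIntegrable _ _
    · exact (hv.mul hrc).intervalIntegrable _ _
  have hMle : M ≤ (C₁ + C₂) * w * (S + W) := by
    have b1 := abs_sum_mul_le (m := e + 1) (l := l) (w := w * M)
      (x := fun i => ∫ y in (0 : ℝ)..1, (1 - y) ^ (α + i) * r y)
      (fun i => (hc₁ i).le) (by positivity) fun i => by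
        refine ((h₁ i p hpn).2 r hrc hr0).trans ?_
        rw [← mul_assoc]
        have := hc₁ i
        gcongr
        exact hwi i
    have b2 := abs_integral_mul_le hω (A := C₂ * w * M)
      (G := fun τ => ∫ y in (0 : ℝ)..1, posPow σ (τ - y) * r y) fun t ht => by
        rw [integral_posPow_left hσ hrc ht]
        refine (h₂ p (by lia) r hrc hr0 t ht).trans ?_
        gcongr
        refine Real.rpow_le_rpow_of_exponent_le hp1 ?_
        linarith [hσ2]
    have b3 : M * M ≤ (C₁ + C₂) * w * (S + W) * M := by
      rw [← sq, hMsq, hT.integral_mul hα0 hσ hω hrc, hqr, zero_add]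
      refine (le_abs_self _).trans ((abs_add_le _ _).trans ((add_le_add b1 b2).trans ?_))
      have : 0 ≤ C₁ * w * M * W + C₂ * w * M * S := by positivity
      rw [← hC₁d, ← hS, ← hW]
      linarith
    rcases hM0.eq_or_lt with h | h
    · rw [← h]; positivity
    · exact le_of_mul_le_mul_right b3 h
  set d : Polynomial ℝ := P - legProj v p with hd
  have hdd : d.natDegree ≤ p := (Polynomial.natDegree_sub_le _ _).trans
    (max_le hP (natDegree_legProj_lt hpn).le)
  have hdo : ∀ n < p, legCoeff (fun x => d.eval x) n = 0 := fun n hn => by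
    have h1 := hPo n hn
    have h2 := legCoeff_sub P.continuous hv n
    have h3 := legCoeff_sub P.continuous (legProj v p).continuous n
    rw [legCoeff_legProj, if_pos hn] at h3
    simp only [hd, Polynomial.eval_sub]
    rw [h3, ← h2]
    exact h1
  have hd0 : d.eval 0 = v 0 - (legProj v p).eval 0 := by rw [hd, Polynomial.eval_sub, hP0]
  have hdn : normSq (fun y => d.eval y) = d.eval 0 ^ 2 * (1 / (2 * p + 1)) := by
    rw [← integral_leg_sq p, ← intervalIntegral.integral_const_mul, normSq]
    refine intervalIntegral.integral_congr fun y hy => ?_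
    rw [uIcc_of_le zero_le_one] at hy
    rw [eval_eq_mul_leg hdd hdo hy]
    ring
  set z : ℝ := (p : ℝ) ^ (-(1 / 2) : ℝ) with hz
  have hz0 : 0 < z := by positivity
  have hz1 : z ≤ 1 := Real.rpow_le_one_of_one_le_of_nonpos hp1 (by norm_num)
  have hz2 : z ^ 2 = 1 / p := by
    rw [hz, ← Real.rpow_natCast (_ ^ _) 2, ← Real.rpow_mul hp0.le]
    norm_num [Real.rpow_neg_one]
  have hcle : |d.eval 0| * z ≤ (C₁ + σ * C₃) * w * (S + W) := by
    have b1 := abs_sum_mul_le (m := e + 1) (l := l) (w := w)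
      (x := fun i => 1 - ∑ n ∈ Finset.range p, (2 * n + 1) * legMoment (α + i) n)
      (fun i => (hc₁ i).le) hw0.le fun i => by
        refine ((h₁ i p hpn).1).trans ?_
        have := hc₁ i
        gcongr
        exact hwi i
    have b2 := abs_integral_mul_le hω (A := σ * C₃ * (p : ℝ) ^ (-σ))
      (G := fun τ => posPow σ τ - ∑ n ∈ Finset.range p, (2 * (n : ℝ) + 1) *
        ∫ y in (0 : ℝ)..1, posPow σ (τ - y) * (leg n).eval y) fun t ht => by
        simp only [fun n => integral_posPow_left hσ (continuous_leg n) ht]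
        rw [posPow_of_nonneg ht.1, rpow_sub_sum_integral hσ hpn ht.1, abs_mul,
          abs_of_pos (by positivity : 0 < σ / 2)]
        have e1 := h₃ p p hpn (by lia) t ht
        have e2 := h₃ p (p - 1) hpn (by lia) t ht
        calc _ ≤ σ / 2 * (C₃ * (p : ℝ) ^ (-σ) + C₃ * (p : ℝ) ^ (-σ)) := by
              gcongr
              exact (abs_add_le _ _).trans (add_le_add e1 e2)
          _ = _ := by ring
    have b3 : (p : ℝ) ^ (-σ) * z ≤ w := by
      rw [hz, ← Real.rpow_add hp0]
      exact Real.rpow_le_rpow_of_exponent_le hp1 (by linarith)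
    rw [hd0, hT.sub_legProj_zero hα0 hσ hω (by lia)]
    calc _ ≤ (C₁ * w * S + σ * C₃ * (p : ℝ) ^ (-σ) * W) * z := by
          gcongr
          exact (abs_add_le _ _).trans (add_le_add b1 b2)
      _ = C₁ * w * S * z + σ * C₃ * W * ((p : ℝ) ^ (-σ) * z) := by ring
      _ ≤ C₁ * w * S * 1 + σ * C₃ * W * w := by gcongr
      _ ≤ _ := by
        have : 0 ≤ C₁ * w * W + σ * C₃ * w * S := by positivity
        linarith
  have hN : normSq (fun y => d.eval y) ≤ ((C₁ + σ * C₃) * w * (S + W)) ^ 2 := by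
    calc _ ≤ d.eval 0 ^ 2 * (1 / p) := by
          rw [hdn]; gcongr; linarith
      _ = (|d.eval 0| * z) ^ 2 := by rw [mul_pow, hz2, sq_abs]
      _ ≤ _ := by gcongr
  have hrn : normSq r ≤ ((C₁ + C₂) * w * (S + W)) ^ 2 := by
    rw [← Real.sq_sqrt (normSq_nonneg r)]; gcongr
  have hfin := normSq_sub_le hrc d.continuous
  have hfun : (fun y => v y - P.eval y) = fun y => r y - d.eval y := by
    funext y; rw [hd, Polynomial.eval_sub, hr]; ring
  rw [hfun]
  refine Real.sqrt_le_iff.2 ⟨by positivity, hfin.trans ?_⟩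
  set X := (C₁ + C₂) * w * (S + W) with hX
  set Y := (C₁ + σ * C₃) * w * (S + W) with hY
  have hX0 : 0 ≤ X := by positivity
  have hY0 : 0 ≤ Y := by positivity
  calc _ ≤ 2 * X ^ 2 + 2 * Y ^ 2 := by gcongr
    _ ≤ (2 * X + 2 * Y) ^ 2 := by nlinarith [mul_nonneg hX0 hY0]
    _ = _ := by rw [hX, hY]; ring

lemma integral_rpow_mul_sub_rpow {α β x : ℝ} (hα : 0 < α) (hβ : 0 < β) (hx : 0 < x) :
    ∫ y in (0 : ℝ)..x, y ^ (α - 1) * (x - y) ^ (β - 1) =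
      Real.Gamma α * Real.Gamma β / Real.Gamma (α + β) * x ^ (α + β - 1) := by
  have h := Complex.betaIntegral_scaled α β hx
  rw [Complex.betaIntegral_eq_Gamma_mul_div _ _ (by simpa) (by simpa)] at h
  have h1 : ∫ y in (0 : ℝ)..x, (y : ℂ) ^ ((α : ℂ) - 1) * ((x : ℂ) - y) ^ ((β : ℂ) - 1) =
      ((∫ y in (0 : ℝ)..x, y ^ (α - 1) * (x - y) ^ (β - 1) : ℝ) : ℂ) := by
    rw [← intervalIntegral.integral_ofReal]
    refine intervalIntegral.integral_congr fun y hy => ?_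
    rw [uIcc_of_le hx.le] at hy
    push_cast
    rw [Complex.ofReal_cpow hy.1, Complex.ofReal_cpow (by linarith [hy.2])]
    push_cast
    rfl
  rw [h1, ← Complex.ofReal_add, Complex.Gamma_ofReal, Complex.Gamma_ofReal, Complex.Gamma_ofReal]
    at h
  apply Complex.ofReal_injective
  rw [h]
  push_cast
  rw [Complex.ofReal_cpow hx.le]
  push_cast
  ring

lemma integral_sub_rpow_mul_sub_rpow {α β t x : ℝ} (hα : 0 < α) (hβ : 0 < β) (hx : t < x) :
    ∫ y in t..x, (x - y) ^ (α - 1) * (y - t) ^ (β - 1) =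
      Real.Gamma α * Real.Gamma β / Real.Gamma (α + β) * (x - t) ^ (α + β - 1) := by
  have h := integral_rpow_mul_sub_rpow hα hβ (sub_pos.2 hx)
  rw [← h]
  have := intervalIntegral.integral_comp_sub_left
    (fun y => y ^ (α - 1) * (x - t - y) ^ (β - 1)) (a := t) (b := x) x
  rw [sub_self] at this
  rw [← this]
  congr 1; funext y; congr 2; ring

lemma intervalIntegrable_sub_rpow_mul_sub_rpow {α β t x : ℝ} (hα : 0 < α) (hβ : 0 < β)
    (hx : t < x) :
    IntervalIntegrable (fun y => (x - y) ^ (α - 1) * (y - t) ^ (β - 1)) volume t x := by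
  by_contra h
  have h1 := integral_sub_rpow_mul_sub_rpow hα hβ hx
  rw [intervalIntegral.integral_undef h] at h1
  have := sub_pos.2 hx
  have h2 := Real.Gamma_pos_of_pos hα
  have h3 := Real.Gamma_pos_of_pos hβ
  have h4 := Real.Gamma_pos_of_pos (add_pos hα hβ)
  have : 0 < Real.Gamma α * Real.Gamma β / Real.Gamma (α + β) * (x - t) ^ (α + β - 1) := by
    positivity
  linarith

/-- The left Riemann–Liouville fractional integral of order `β` based at `a`. -/
noncomputable def fracInt (β a : ℝ) (g : ℝ → ℝ) (x : ℝ) : ℝ :=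
  1 / Real.Gamma β * ∫ y in a..x, (x - y) ^ (β - 1) * g y

lemma fracInt_congr {β a x : ℝ} {f g : ℝ → ℝ} (hax : a ≤ x) (h : ∀ y ∈ Ioo a x, f y = g y) :
    fracInt β a f x = fracInt β a g x := by
  rw [fracInt, fracInt, intervalIntegral.integral_of_le hax, intervalIntegral.integral_of_le hax,
    integral_Ioc_eq_integral_Ioo, integral_Ioc_eq_integral_Ioo]
  congr 1
  exact setIntegral_congr_fun measurableSet_Ioo fun y hy => by simp only [h y hy]

lemma fracInt_rpow {β γ a x : ℝ} (hβ : 0 < β) (hγ : 0 < γ) (hax : a < x) :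
    fracInt β a (fun y => (y - a) ^ (γ - 1)) x =
      Real.Gamma γ / Real.Gamma (β + γ) * (x - a) ^ (β + γ - 1) := by
  rw [fracInt, integral_sub_rpow_mul_sub_rpow hβ hγ hax]
  have := (Real.Gamma_pos_of_pos hβ).ne'
  field_simp

lemma fracInt_add {β a x : ℝ} {f g : ℝ → ℝ}
    (hf : IntervalIntegrable (fun y => (x - y) ^ (β - 1) * f y) volume a x)
    (hg : IntervalIntegrable (fun y => (x - y) ^ (β - 1) * g y) volume a x) :
    fracInt β a (fun y => f y + g y) x = fracInt β a f x + fracInt β a g x := by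
  rw [fracInt, fracInt, fracInt, ← mul_add, ← intervalIntegral.integral_add hf hg]
  simp_rw [mul_add]

lemma fracInt_const_mul (β a c x : ℝ) (f : ℝ → ℝ) :
    fracInt β a (fun y => c * f y) x = c * fracInt β a f x := by
  have h : ∀ y, (x - y) ^ (β - 1) * (c * f y) = c * ((x - y) ^ (β - 1) * f y) := fun y => by ring
  simp only [fracInt, h, intervalIntegral.integral_const_mul]
  ring

/-- The integrable truncated power kernel. -/
noncomputable def kerPow (β s : ℝ) : ℝ := (Ioi (0 : ℝ)).indicator (fun s => s ^ (β - 1)) s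

lemma measurable_kerPow (β : ℝ) : Measurable (kerPow β) :=
  (measurable_id.pow_const _).indicator measurableSet_Ioi

lemma kerPow_nonneg (β s : ℝ) : 0 ≤ kerPow β s :=
  indicator_nonneg (fun s (hs : 0 < s) => Real.rpow_nonneg hs.le _) s

lemma kerPow_of_pos {β s : ℝ} (hs : 0 < s) : kerPow β s = s ^ (β - 1) := indicator_of_mem hs _

lemma kerPow_of_nonpos {β s : ℝ} (hs : s ≤ 0) : kerPow β s = 0 :=
  indicator_of_notMem (not_lt.2 hs) _

lemma kerPow_mul_eq_indicator {α β x t : ℝ} (a y : ℝ) (hy : y ∈ Ioo a x) :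
    kerPow α (x - y) * kerPow β (y - t) =
      (Ioi t).indicator (fun y => (x - y) ^ (α - 1) * (y - t) ^ (β - 1)) y := by
  by_cases h : t < y
  · rw [indicator_of_mem (show y ∈ Ioi t from h), kerPow_of_pos (sub_pos.2 hy.2), kerPow_of_pos (sub_pos.2 h)]
  · rw [indicator_of_notMem (show y ∉ Ioi t from h),
      kerPow_of_nonpos (by linarith : y - t ≤ 0), mul_zero]

lemma integrable_kerPow_mul {α β a x t : ℝ} (hα : 0 < α) (hβ : 0 < β) (ht : t ∈ Ioo a x) :
    Integrable (fun y => kerPow α (x - y) * kerPow β (y - t)) (volume.restrict (Ioo a x)) := by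
  have h := intervalIntegrable_sub_rpow_mul_sub_rpow hα hβ ht.2
  rw [intervalIntegrable_iff_integrableOn_Ioo_of_le ht.2.le] at h
  have h1 : IntegrableOn ((Ioi t).indicator
      (fun y => (x - y) ^ (α - 1) * (y - t) ^ (β - 1))) (Ioo a x) := by
    rw [integrableOn_indicator_iff measurableSet_Ioi]
    exact h.mono_set fun y hy => ⟨hy.1, hy.2.2⟩
  refine h1.congr_fun (fun y hy => ?_) measurableSet_Ioo
  exact (kerPow_mul_eq_indicator a y hy).symm

lemma integral_kerPow_mul {α β a x t : ℝ} (hα : 0 < α) (hβ : 0 < β) (ht : t ∈ Ioo a x) :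
    ∫ y in Ioo a x, kerPow α (x - y) * kerPow β (y - t) =
      Real.Gamma α * Real.Gamma β / Real.Gamma (α + β) * (x - t) ^ (α + β - 1) := by
  rw [← integral_sub_rpow_mul_sub_rpow hα hβ ht.2, intervalIntegral.integral_of_le ht.2.le,
    integral_Ioc_eq_integral_Ioo, setIntegral_congr_fun measurableSet_Ioo
      (fun y hy => kerPow_mul_eq_indicator a y hy),
    setIntegral_indicator measurableSet_Ioi]
  congr 2
  ext y
  exact ⟨fun hy => ⟨hy.2, hy.1.2⟩, fun hy => ⟨⟨ht.1.trans hy.1, hy.2⟩, hy.1⟩⟩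

lemma integrable_kerPow_mul_prod {α β a x : ℝ} (hα : 0 < α) (hβ : 0 < β) (hαβ : 1 ≤ α + β)
    {g : ℝ → ℝ} (hg : Integrable g (volume.restrict (Ioo a x))) :
    Integrable (fun z : ℝ × ℝ => kerPow α (x - z.1) * kerPow β (z.1 - z.2) * g z.2)
      ((volume.restrict (Ioo a x)).prod (volume.restrict (Ioo a x))) := by
  have hm : AEStronglyMeasurable
      (fun z : ℝ × ℝ => kerPow α (x - z.1) * kerPow β (z.1 - z.2) * g z.2)
      ((volume.restrict (Ioo a x)).prod (volume.restrict (Ioo a x))) := by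
    have h1 := measurable_kerPow α
    have h2 := measurable_kerPow β
    refine AEStronglyMeasurable.mul ?_ hg.1.comp_snd
    exact (by fun_prop : Measurable fun z : ℝ × ℝ =>
      kerPow α (x - z.1) * kerPow β (z.1 - z.2)).aestronglyMeasurable
  rw [integrable_prod_iff' hm]
  constructor
  · filter_upwards [ae_restrict_mem measurableSet_Ioo] with t ht
    exact (integrable_kerPow_mul hα hβ ht).mul_const _
  · have hb : Integrable (fun t => (Real.Gamma α * Real.Gamma β / Real.Gamma (α + β) *
        (x - t) ^ (α + β - 1)) * |g t|) (volume.restrict (Ioo a x)) := by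
      have hc : Continuous fun t : ℝ => (x - t) ^ (α + β - 1) :=
        (continuous_const.sub continuous_id).rpow_const fun _ => Or.inr (by linarith)
      refine hg.abs.bdd_mul (c := |Real.Gamma α * Real.Gamma β / Real.Gamma (α + β)| *
        (x - a) ^ (α + β - 1)) (continuous_const.mul hc).aestronglyMeasurable ?_
      filter_upwards [ae_restrict_mem measurableSet_Ioo] with t ht
      rw [norm_mul, Real.norm_eq_abs, Real.norm_eq_abs,
        abs_of_nonneg (Real.rpow_nonneg (by linarith [ht.2]) _ : 0 ≤ (x - t) ^ (α + β - 1))]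
      have h1 := ht.1.le
      have h2 := sub_nonneg.2 ht.2.le
      gcongr
    refine hb.congr ?_
    filter_upwards [ae_restrict_mem measurableSet_Ioo] with t ht
    rw [← integral_kerPow_mul hα hβ ht, ← integral_mul_const]
    congr 1; funext y
    rw [norm_mul, Real.norm_eq_abs, Real.norm_eq_abs,
      abs_of_nonneg (mul_nonneg (kerPow_nonneg _ _) (kerPow_nonneg _ _))]

lemma integral_kerPow_inner {α β a x y : ℝ} (hβ : 0 < β) (g : ℝ → ℝ) (hy : y ∈ Ioo a x) :
    ∫ t in Ioo a x, kerPow α (x - y) * kerPow β (y - t) * g t =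
      Real.Gamma β * ((x - y) ^ (α - 1) * fracInt β a g y) := by
  have hΓ := (Real.Gamma_pos_of_pos hβ).ne'
  have h : ∀ t ∈ Ioo a x, kerPow α (x - y) * kerPow β (y - t) * g t =
      (Iio y).indicator (fun t => (x - y) ^ (α - 1) * ((y - t) ^ (β - 1) * g t)) t := by
    intro t _
    rw [kerPow_of_pos (sub_pos.2 hy.2)]
    by_cases hty : t < y
    · rw [indicator_of_mem (show t ∈ Iio y from hty), kerPow_of_pos (sub_pos.2 hty), mul_assoc]
    · rw [indicator_of_notMem (show t ∉ Iio y from hty),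
        kerPow_of_nonpos (by linarith : y - t ≤ 0)]
      simp
  rw [setIntegral_congr_fun measurableSet_Ioo h, setIntegral_indicator measurableSet_Iio,
    integral_const_mul, fracInt, intervalIntegral.integral_of_le hy.1.le,
    integral_Ioc_eq_integral_Ioo]
  have : Ioo a x ∩ Iio y = Ioo a y := by
    ext t
    exact ⟨fun ht => ⟨ht.1.1, ht.2⟩, fun ht => ⟨⟨ht.1, ht.2.trans hy.2⟩, ht.2⟩⟩
  rw [this]
  field_simp

lemma intervalIntegrable_sub_rpow_mul_fracInt {α β a x : ℝ} (hα : 0 < α) (hβ : 0 < β)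
    (hαβ : 1 ≤ α + β) (hax : a < x) {g : ℝ → ℝ} (hg : IntervalIntegrable g volume a x) :
    IntervalIntegrable (fun y => (x - y) ^ (α - 1) * fracInt β a g y) volume a x := by
  rw [intervalIntegrable_iff_integrableOn_Ioo_of_le hax.le] at hg ⊢
  have h := (integrable_kerPow_mul_prod hα hβ hαβ hg).integral_prod_left.const_mul
    (1 / Real.Gamma β)
  refine h.congr ?_
  filter_upwards [ae_restrict_mem measurableSet_Ioo] with y hy
  have hΓ := (Real.Gamma_pos_of_pos hβ).ne'
  rw [integral_kerPow_inner hβ g hy]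
  field_simp

/-- The semigroup property of fractional integrals. -/
lemma fracInt_fracInt {α β a x : ℝ} (hα : 0 < α) (hβ : 0 < β) (hαβ : 1 ≤ α + β) (hax : a < x)
    {g : ℝ → ℝ} (hg : IntervalIntegrable g volume a x) :
    fracInt α a (fracInt β a g) x = fracInt (α + β) a g x := by
  rw [intervalIntegrable_iff_integrableOn_Ioo_of_le hax.le] at hg
  have h := integral_integral_swap
    (f := fun y t => kerPow α (x - y) * kerPow β (y - t) * g t)
    (integrable_kerPow_mul_prod hα hβ hαβ hg)
  have h1 := (Real.Gamma_pos_of_pos hα).ne'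
  have h2 := (Real.Gamma_pos_of_pos hβ).ne'
  have h3 := (Real.Gamma_pos_of_pos (add_pos hα hβ)).ne'
  rw [setIntegral_congr_fun measurableSet_Ioo
    (fun y hy => integral_kerPow_inner (α := α) hβ g hy), integral_const_mul] at h
  have h4 : ∀ t ∈ Ioo a x, ∫ y in Ioo a x, kerPow α (x - y) * kerPow β (y - t) * g t =
      Real.Gamma α * Real.Gamma β / Real.Gamma (α + β) * ((x - t) ^ (α + β - 1) * g t) := by
    intro t ht
    rw [integral_mul_const, integral_kerPow_mul hα hβ ht, mul_assoc]
  rw [setIntegral_congr_fun measurableSet_Ioo h4, integral_const_mul] at h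
  rw [fracInt, fracInt, intervalIntegral.integral_of_le hax.le,
    intervalIntegral.integral_of_le hax.le,
    integral_Ioc_eq_integral_Ioo, integral_Ioc_eq_integral_Ioo]
  field_simp at h ⊢
  linear_combination h

lemma exists_tendsto_nhdsGT_of_hasDerivAt {a b : ℝ} (hab : a < b) {f f' : ℝ → ℝ}
    (hd : ∀ x ∈ Ioo a b, HasDerivAt f (f' x) x) (hi : IntervalIntegrable f' volume a b) :
    ∃ l, Tendsto f (nhdsWithin a (Ioi a)) (nhds l) := by
  obtain ⟨c, hc⟩ := exists_between hab
  have hI : IntegrableOn f' (uIcc a c) := by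
    rw [uIcc_of_le hc.1.le, integrableOn_Icc_iff_integrableOn_Ioc,
      ← intervalIntegrable_iff_integrableOn_Ioc_of_le hc.1.le]
    exact hi.mono_set (uIcc_subset_uIcc left_mem_uIcc (mem_uIcc_of_le hc.1.le hc.2.le))
  have hcont := intervalIntegral.continuousOn_primitive_interval_left hI
  have h1 : Tendsto (fun x => ∫ y in x..c, f' y) (nhdsWithin a (Ioi a))
      (nhds (∫ y in a..c, f' y)) := by
    rw [uIcc_of_le hc.1.le] at hcont
    rw [← nhdsWithin_Ioc_eq_nhdsGT hc.1]
    exact (hcont a ⟨le_rfl, hc.1.le⟩).mono_left (nhdsWithin_mono _ Ioc_subset_Icc_self)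
  refine ⟨f c - ∫ y in a..c, f' y, (h1.const_sub (f c)).congr' ?_⟩
  filter_upwards [Ioc_mem_nhdsGT hc.1] with x hx
  rw [intervalIntegral.integral_eq_sub_of_hasDerivAt (f := f)]
  · ring
  · intro y hy
    rw [uIcc_of_le hx.2] at hy
    exact hd y ⟨hx.1.trans_le hy.1, hy.2.trans_lt hc.2⟩
  · exact hi.mono_set (uIcc_subset_uIcc (mem_uIcc_of_le hx.1.le (hx.2.trans hc.2.le))
      (mem_uIcc_of_le hc.1.le hc.2.le))

lemma eq_add_fracInt_one {a b : ℝ} {f f' : ℝ → ℝ} {l : ℝ}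
    (hd : ∀ x ∈ Ioo a b, HasDerivAt f (f' x) x) (hi : IntervalIntegrable f' volume a b)
    (hl : Tendsto f (nhdsWithin a (Ioi a)) (nhds l)) {x : ℝ} (hx : x ∈ Ioo a b) :
    f x = l + fracInt 1 a f' x := by
  have h := intervalIntegral.integral_eq_sub_of_hasDerivAt_of_tendsto (f := f) (f' := f') hx.1
    (fun y hy => hd y ⟨hy.1, hy.2.trans hx.2⟩)
    (hi.mono_set (uIcc_subset_uIcc left_mem_uIcc (mem_uIcc_of_le hx.1.le hx.2.le))) hl
    ((hd x hx).continuousAt.tendsto.mono_left nhdsWithin_le_nhds)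
  simp [fracInt, h]

lemma fracInt_sum {β a x : ℝ} (s : Finset ℕ) (f : ℕ → ℝ → ℝ)
    (hf : ∀ i ∈ s, IntervalIntegrable (fun y => (x - y) ^ (β - 1) * f i y) volume a x) :
    fracInt β a (fun y => ∑ i ∈ s, f i y) x = ∑ i ∈ s, fracInt β a (f i) x := by
  simp only [fracInt, Finset.mul_sum]
  rw [intervalIntegral.integral_finsetSum hf, Finset.mul_sum]

lemma fracInt_of_taylor {β a x : ℝ} (hβ : 0 < β) (hax : a < x) {m : ℕ} (hm : 1 ≤ m)
    {g W : ℝ → ℝ} {L : ℕ → ℝ} (hW : IntervalIntegrable W volume a x)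
    (hg : ∀ y ∈ Ioo a x, g y =
      ∑ i ∈ Finset.range m, L i / Real.Gamma (i + 1) * (y - a) ^ (i : ℝ) + fracInt m a W y) :
    fracInt β a g x =
      ∑ i ∈ Finset.range m, L i / Real.Gamma (β + i + 1) * (x - a) ^ (β + i) +
        fracInt (β + m) a W x := by
  have hm' : (1 : ℝ) ≤ m := by exact_mod_cast hm
  have hint : ∀ i ∈ Finset.range m, IntervalIntegrable (fun y =>
      (x - y) ^ (β - 1) * (L i / Real.Gamma (i + 1) * (y - a) ^ ((i : ℝ) + 1 - 1)))
      volume a x := by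
    intro i _
    refine ((intervalIntegrable_sub_rpow_mul_sub_rpow hβ
      (by positivity : (0 : ℝ) < i + 1) hax).const_mul (L i / Real.Gamma (i + 1))).congr
      fun y _ => ?_
    ring
  have hg' : ∀ y ∈ Ioo a x, g y = ∑ i ∈ Finset.range m,
      L i / Real.Gamma (i + 1) * (y - a) ^ ((i : ℝ) + 1 - 1) + fracInt m a W y := by
    simpa using hg
  rw [fracInt_congr hax.le hg', fracInt_add _
    (intervalIntegrable_sub_rpow_mul_fracInt hβ (by linarith) (by linarith) hax hW),
    fracInt_sum _ _ hint, fracInt_fracInt hβ (by linarith) (by linarith) hax hW]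
  · congr 1
    refine Finset.sum_congr rfl fun i _ => ?_
    have hi : (0 : ℝ) < i + 1 := by positivity
    have := (Real.Gamma_pos_of_pos hi).ne'
    rw [fracInt_const_mul, fracInt_rpow hβ hi hax, show β + ((i : ℝ) + 1) = β + i + 1 by ring,
      add_sub_cancel_right]
    field_simp
  · simp only [Finset.mul_sum]
    simpa only [Finset.sum_fn] using IntervalIntegrable.sum _ hint

/-- Taylor's formula with integral remainder. -/
lemma taylor_fracInt {a b : ℝ} {f : ℕ → ℝ → ℝ} {L : ℕ → ℝ} {n : ℕ} (hn : 1 ≤ n)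
    (hd : ∀ i < n, ∀ x ∈ Ioo a b, HasDerivAt (f i) (f (i + 1) x) x)
    (hi : ∀ i ≤ n, IntervalIntegrable (f i) volume a b)
    (hl : ∀ i < n, Tendsto (f i) (nhdsWithin a (Ioi a)) (nhds (L i))) :
    ∀ x ∈ Ioo a b, f 0 x =
      ∑ i ∈ Finset.range n, L i / Real.Gamma (i + 1) * (x - a) ^ (i : ℝ) +
        fracInt n a (f n) x := by
  induction n, hn using Nat.le_induction with
  | base =>
    intro x hx
    simpa using eq_add_fracInt_one (hd 0 one_pos) (hi 1 le_rfl) (hl 0 one_pos) hx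
  | succ n hn ih =>
    intro x hx
    have hn' : (0 : ℝ) < n := by exact_mod_cast hn
    have hsub : uIcc a x ⊆ uIcc a b :=
      uIcc_subset_uIcc left_mem_uIcc (mem_uIcc_of_le hx.1.le hx.2.le)
    have h1 := fracInt_of_taylor (g := f n) (W := f (n + 1)) (L := fun _ => L n) hn' hx.1 le_rfl
      ((hi (n + 1) le_rfl).mono_set hsub) (fun y hy => by
        simpa using eq_add_fracInt_one (hd n n.lt_succ_self) (hi (n + 1) le_rfl)
          (hl n n.lt_succ_self) ⟨hy.1, hy.2.trans hx.2⟩)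
    rw [ih (fun i h => hd i (h.trans n.lt_succ_self)) (fun i h => hi i (h.trans n.le_succ))
      (fun i h => hl i (h.trans n.lt_succ_self)) x hx, h1]
    simp [Finset.sum_range_succ, add_assoc]

lemma exists_eq_add_fracInt {k m : ℕ} (hk : 1 ≤ k) (hm : 1 ≤ m) {α : ℝ} (hα0 : 0 < α)
    (hα2 : α < k) {a b : ℝ} (hab : a < b) {u : ℝ → ℝ} {L : ℕ → ℝ} (h : MemULOn k m α a b u L) :
    ∃ l : ℕ → ℝ, ∀ x ∈ Ioo a b, u x =
      ∑ i ∈ Finset.range k, l i / Real.Gamma (i + 1) * (x - a) ^ i +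
        (∑ i ∈ Finset.range m, L i / Real.Gamma (α + i + 1) * (x - a) ^ (α + i) +
          fracInt (α + m) a (iteratedDeriv m (caputoL k α a u)) x) := by
  obtain ⟨-, hd, hi, hd', hi', hl'⟩ := h
  have hl : ∀ i, ∃ l, i < k → Tendsto (iteratedDeriv i u) (nhdsWithin a (Ioi a)) (nhds l) := by
    intro i
    by_cases hik : i < k
    · obtain ⟨l, hl⟩ := exists_tendsto_nhdsGT_of_hasDerivAt hab (hd i hik) (hi (i + 1) hik)
      exact ⟨l, fun _ => hl⟩
    · exact ⟨0, fun h => absurd h hik⟩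
  choose l hl using hl
  refine ⟨l, fun x hx => ?_⟩
  have hsub : uIcc a x ⊆ uIcc a b :=
    uIcc_subset_uIcc left_mem_uIcc (mem_uIcc_of_le hx.1.le hx.2.le)
  have h1 := taylor_fracInt hk hd hi hl x hx
  rw [iteratedDeriv_zero] at h1
  simp only [Real.rpow_natCast] at h1
  have h2 := fracInt_of_taylor hα0 hx.1 hm ((hi' m le_rfl).mono_set hsub)
    (fun y hy => taylor_fracInt hm hd' hi' hl' y ⟨hy.1, hy.2.trans hx.2⟩)
  have h3 : fracInt α a (iteratedDeriv 0 (caputoL k α a u)) x =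
      fracInt k a (iteratedDeriv k u) x := by
    rw [iteratedDeriv_zero]
    have hk' : (1 : ℝ) ≤ k := by exact_mod_cast hk
    have := fracInt_fracInt hα0 (sub_pos.2 hα2) (by linarith) hx.1 ((hi k le_rfl).mono_set hsub)
    rwa [add_sub_cancel] at this
  rw [h1, ← h3, h2]

lemma exists_continuous_hasFracTaylor {m : ℕ} {α : ℝ} (hα : 0 ≤ α) (hσ : 0 < α + m - 1)
    (q : Polynomial ℝ) (l : ℕ → ℝ) {ω : ℝ → ℝ} (hω : IntervalIntegrable ω volume 0 1) :
    ∃ v, Continuous v ∧ HasFracTaylor m α v q l ω := by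
  have hmeas : AEStronglyMeasurable ω (volume.restrict (uIoc 0 1)) := by
    rw [uIoc_of_le zero_le_one]; exact hω.1.1
  have hc : Continuous fun y : ℝ => ∫ τ in (0 : ℝ)..1, posPow (α + m - 1) (τ - max y 0) * ω τ := by
    have hp := continuous_posPow hσ
    refine intervalIntegral.continuous_of_dominated_interval (bound := fun τ => |ω τ|)
      (fun y => ?_) (fun y => ?_) hω.abs ?_
    · exact (by fun_prop : Continuous fun τ => posPow (α + m - 1) (τ - max y 0)
        ).aestronglyMeasurable.mul hmeas
    · refine Eventually.of_forall fun τ hτ => ?_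
      rw [uIoc_of_le zero_le_one] at hτ
      rw [norm_mul, Real.norm_eq_abs, Real.norm_eq_abs, abs_of_nonneg (posPow_nonneg _ _)]
      exact mul_le_of_le_one_left (abs_nonneg _)
        (posPow_le_one hσ (by linarith [hτ.2, le_max_right y 0]))
    · exact Eventually.of_forall fun τ _ => by fun_prop
  refine ⟨fun y => q.eval y + ∑ i ∈ Finset.range m, l i * (1 - y) ^ (α + i) +
    ∫ τ in (0 : ℝ)..1, posPow (α + m - 1) (τ - max y 0) * ω τ, ?_, fun y hy => ?_⟩
  · refine (q.continuous.add (continuous_finsetSum _ fun i _ => continuous_const.mul ?_)).add hc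
    exact (continuous_const.sub continuous_id).rpow_const fun _ => Or.inr (by positivity)
  · simp only [max_eq_left hy.1]
    rw [integral_posPow_right hσ hω hy]

lemma intervalIntegrable_comp_affine {a h : ℝ} (hh : 0 < h) {W : ℝ → ℝ}
    (hW : IntervalIntegrable W volume a (a + h)) :
    IntervalIntegrable (fun τ => W (a + h - h * τ)) volume 0 1 := by
  have h1 := (hW.comp_sub_left (a + h)).symm
  rw [sub_self, add_sub_cancel_left] at h1
  have h2 := h1.comp_mul_left (c := h)
  rwa [zero_div, div_self hh.ne'] at h2

lemma integral_comp_affine {a h : ℝ} (hh : 0 < h) (y : ℝ) (f : ℝ → ℝ) :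
    h * ∫ τ in y..1, f (a + h - h * τ) = ∫ x in a..(a + h - h * y), f x := by
  rw [intervalIntegral.integral_comp_sub_mul f hh.ne', smul_eq_mul, mul_one, add_sub_cancel_right]
  field_simp

lemma fracInt_affine {β a h y : ℝ} (hh : 0 < h) (hy : y ∈ Ioo (0 : ℝ) 1) (W : ℝ → ℝ) :
    fracInt β a W (a + h - h * y) =
      ∫ τ in y..1, (τ - y) ^ (β - 1) * (h ^ β / Real.Gamma β * W (a + h - h * τ)) := by
  rw [fracInt, ← integral_comp_affine hh, ← mul_assoc, ← intervalIntegral.integral_const_mul]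
  refine intervalIntegral.integral_congr fun τ hτ => ?_
  rw [uIcc_of_le hy.2.le] at hτ
  have h1 : a + h - h * y - (a + h - h * τ) = h * (τ - y) := by ring
  simp only [h1]
  rw [Real.mul_rpow hh.le (by linarith [hτ.1]), Real.rpow_sub_one hh.ne']
  field_simp

lemma eval_comp_affine (P : Polynomial ℝ) (c d y : ℝ) :
    (P.comp (Polynomial.C c - Polynomial.C d * Polynomial.X)).eval y = P.eval (c - d * y) := by
  simp

lemma natDegree_comp_affine_le (P : Polynomial ℝ) (c d : ℝ) :
    (P.comp (Polynomial.C c - Polynomial.C d * Polynomial.X)).natDegree ≤ P.natDegree := by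
  have h : (Polynomial.C c - Polynomial.C d * Polynomial.X).natDegree ≤ 1 := by compute_degree
  exact Polynomial.natDegree_comp_le.trans (mul_le_of_le_one_right (Nat.zero_le _) h)

/-- The pull-back of a function in the fractional space to the reference interval. -/
lemma exists_hasFracTaylor_comp_affine {k m : ℕ} (hk : 1 ≤ k) (hm : 1 ≤ m) {α : ℝ} (hα0 : 0 < α)
    (hα2 : α < k) {a h : ℝ} (hh : 0 < h) {u : ℝ → ℝ} {L : ℕ → ℝ}
    (hu : MemULOn k m α a (a + h) u L) :
    ∃ (v : ℝ → ℝ) (q : Polynomial ℝ), Continuous v ∧ q.natDegree < k ∧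
      (∀ y ∈ Icc (0 : ℝ) 1, v y = u (a + h - h * y)) ∧
      HasFracTaylor m α v q (fun i => L i / Real.Gamma (α + i + 1) * h ^ (α + i))
        (fun τ => h ^ (α + m) / Real.Gamma (α + m) *
          iteratedDeriv m (caputoL k α a u) (a + h - h * τ)) := by
  have hm' : (1 : ℝ) ≤ m := by exact_mod_cast hm
  obtain ⟨l, hl⟩ := exists_eq_add_fracInt hk hm hα0 hα2 (by linarith : a < a + h) hu
  set q : Polynomial ℝ := ∑ i ∈ Finset.range k, Polynomial.C (l i / Real.Gamma (i + 1) * h ^ i) *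
    (1 - Polynomial.X) ^ i with hq
  have hqd : q.natDegree < k := by
    refine (Polynomial.natDegree_sum_le_of_forall_le (n := k - 1) _ _ fun i hi => ?_).trans_lt
      (by lia)
    have h1 : (1 - Polynomial.X : Polynomial ℝ).natDegree ≤ 1 := by compute_degree
    refine (Polynomial.natDegree_C_mul_le _ _).trans (Polynomial.natDegree_pow_le.trans ?_)
    have := Finset.mem_range.1 hi
    exact (Nat.mul_le_mul_left i h1).trans (by lia)
  obtain ⟨v, hvc, hv⟩ := exists_continuous_hasFracTaylor (m := m) (α := α) hα0.le (by linarith) q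
    (fun i => L i / Real.Gamma (α + i + 1) * h ^ (α + i))
    ((intervalIntegrable_comp_affine hh (hu.2.2.2.2.1 m le_rfl)).const_mul
      (h ^ (α + m) / Real.Gamma (α + m)))
  have heq : EqOn v (fun y => u (a + h - h * y)) (Ioo 0 1) := by
    intro y hy
    have hx : a + h - h * y ∈ Ioo a (a + h) := ⟨by nlinarith [hy.2], by nlinarith [hy.1]⟩
    have h1 : a + h - h * y - a = h * (1 - y) := by ring
    have h2 : (0 : ℝ) ≤ 1 - y := by linarith [hy.2]
    simp only
    rw [hv y (Ioo_subset_Icc_self hy), hl _ hx, fracInt_affine hh hy, h1, hq,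
      Polynomial.eval_finsetSum]
    simp only [Polynomial.eval_mul, Polynomial.eval_C, Polynomial.eval_pow, Polynomial.eval_sub,
      Polynomial.eval_one, Polynomial.eval_X, mul_pow, Real.mul_rpow hh.le h2, mul_assoc, add_assoc]
  have hcont : ContinuousOn (fun y => u (a + h - h * y)) (Icc 0 1) :=
    hu.1.comp (by fun_prop) fun y hy => ⟨by nlinarith [hy.2], by nlinarith [hy.1]⟩
  exact ⟨v, q, hvc, hqd, heq.of_subset_closure hvc.continuousOn hcont Ioo_subset_Icc_self
    (by rw [closure_Ioo zero_ne_one]), hv⟩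

lemma exists_sum_abs_add_integral_le (m : ℕ) (hm : 1 ≤ m) {α : ℝ} (hα0 : 0 < α) :
    ∃ K > (0 : ℝ), ∀ a h : ℝ, 0 < h → h < 2 → ∀ (L : ℕ → ℝ) (W : ℝ → ℝ),
      ∑ i ∈ Finset.range m, |L i / Real.Gamma (α + i + 1) * h ^ (α + i)| +
          ∫ τ in (0 : ℝ)..1, |h ^ (α + m) / Real.Gamma (α + m) * W (a + h - h * τ)| ≤
        K * h ^ α * ((∫ x in a..(a + h), |W x|) + ∑ i ∈ Finset.range m, |L i|) := by
  have hm' : (1 : ℝ) ≤ m := by exact_mod_cast hm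
  have hΓ : ∀ i : ℕ, 0 < Real.Gamma (α + i + 1) := fun i => Real.Gamma_pos_of_pos (by positivity)
  have hΓm : 0 < Real.Gamma (α + m) := Real.Gamma_pos_of_pos (by positivity)
  set S := ∑ i ∈ Finset.range m, 2 ^ i / Real.Gamma (α + i + 1) with hS
  have hS0 : 0 ≤ S := Finset.sum_nonneg fun i _ => by have := hΓ i; positivity
  refine ⟨S + 2 ^ m / Real.Gamma (α + m), by positivity, fun a h hh h2 L W => ?_⟩
  have hW0 : 0 ≤ ∫ x in a..(a + h), |W x| :=
    intervalIntegral.integral_nonneg (by linarith) fun _ _ => abs_nonneg _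
  have hL0 : 0 ≤ ∑ i ∈ Finset.range m, |L i| := Finset.sum_nonneg fun _ _ => abs_nonneg _
  have h1 : ∑ i ∈ Finset.range m, |L i / Real.Gamma (α + i + 1) * h ^ (α + i)| ≤
      S * h ^ α * ∑ i ∈ Finset.range m, |L i| := by
    rw [Finset.mul_sum]
    refine Finset.sum_le_sum fun i hi => ?_
    have hi' := hΓ i
    have h3 : 2 ^ i / Real.Gamma (α + i + 1) ≤ S :=
      Finset.single_le_sum (f := fun i : ℕ => 2 ^ i / Real.Gamma (α + i + 1))
        (fun j _ => by have := hΓ j; positivity) hi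
    rw [abs_mul, abs_div, abs_of_pos hi', abs_of_pos (Real.rpow_pos_of_pos hh _),
      Real.rpow_add hh, Real.rpow_natCast]
    calc |L i| / Real.Gamma (α + i + 1) * (h ^ α * h ^ i)
        ≤ |L i| / Real.Gamma (α + i + 1) * (h ^ α * 2 ^ i) := by gcongr
      _ = 2 ^ i / Real.Gamma (α + i + 1) * h ^ α * |L i| := by ring
      _ ≤ S * h ^ α * |L i| := by gcongr
  have h3 : ∫ τ in (0 : ℝ)..1, |h ^ (α + m) / Real.Gamma (α + m) * W (a + h - h * τ)| ≤
      2 ^ m / Real.Gamma (α + m) * h ^ α * ∫ x in a..(a + h), |W x| := by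
    have h4 := integral_comp_affine (a := a) hh 0 fun x => |W x|
    rw [mul_zero, sub_zero] at h4
    have h5 : h ^ (α + m) = h ^ α * h ^ (m - 1) * h := by
      rw [mul_assoc, ← pow_succ, Nat.sub_add_cancel hm, Real.rpow_add hh, Real.rpow_natCast]
    have h6 : h ^ (m - 1) ≤ 2 ^ m :=
      (pow_le_pow_left₀ hh.le h2.le _).trans (pow_le_pow_right₀ one_le_two (Nat.sub_le _ _))
    simp only [abs_mul, intervalIntegral.integral_const_mul]
    rw [← h4, abs_of_pos (by positivity : 0 < h ^ (α + m) / Real.Gamma (α + m)), h5]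
    have h7 : 0 ≤ h * ∫ τ in (0 : ℝ)..1, |W (a + h - h * τ)| := by rwa [h4]
    calc h ^ α * h ^ (m - 1) * h / Real.Gamma (α + m) * ∫ τ in (0 : ℝ)..1, |W (a + h - h * τ)|
        = h ^ (m - 1) / Real.Gamma (α + m) * h ^ α *
            (h * ∫ τ in (0 : ℝ)..1, |W (a + h - h * τ)|) := by ring
      _ ≤ _ := by gcongr
  have h8 : 0 ≤ S * h ^ α := by positivity
  have h9 : 0 ≤ 2 ^ m / Real.Gamma (α + m) * h ^ α := by positivity
  nlinarith [mul_nonneg h8 hW0, mul_nonneg h9 hL0]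

end FracApprox

/-- scaled `L²` estimate for the Gauss–Radau projection `π_p^−`
on `(a, a+h)` for `u ∈ 𝒰^{α,m}_{a+}((a,a+h))`. -/
theorem stmt_14 (k m : ℕ) (hk : 1 ≤ k) (hm : 1 ≤ m) (α : ℝ)
    (hα1 : (k : ℝ) - 1 < α) (hα2 : α < (k : ℝ)) (hαint : ∀ j : ℤ, α ≠ (j : ℝ))
    (hαm : 1 / 2 < α + (m : ℝ)) :
    ∃ C > (0 : ℝ), ∀ a h : ℝ, 0 < h → h < 2 →
      ∀ p : ℕ, α + (m : ℝ) < (p : ℝ) + 1 →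
        ∀ (u : ℝ → ℝ) (L : ℕ → ℝ), MemULOn k m α a (a + h) u L →
          ∀ P : Polynomial ℝ, P.natDegree ≤ p →
            (∀ v : Polynomial ℝ, v.natDegree < p →
                ∫ x in a..(a + h), (P.eval x - u x) * v.eval x = 0) →
            P.eval (a + h) = u (a + h) →
            Real.sqrt (∫ x in a..(a + h), (u x - P.eval x) ^ 2) ≤
              C * h ^ (α + 1 / 2) *
                (p : ℝ) ^ (-(min (2 * α + 1) (α + (m : ℝ) - 1 / 2))) *
                UsemiLOn k m α a (a + h) u L := by
  open FracApprox in
  have hk' : (1 : ℝ) ≤ k := by exact_mod_cast hk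
  have hα0 : 0 < α := by linarith
  obtain ⟨C, hC, hrad⟩ := exists_radau_error_le hk hm hα1 hα2
  obtain ⟨K, hK, hbound⟩ := exists_sum_abs_add_integral_le m hm hα0
  refine ⟨C * K, by positivity, fun a h hh h2 p hp u L hu P hP horth hPb => ?_⟩
  have hkp : k + m ≤ p + 1 := by
    have : ((k + m : ℕ) : ℝ) < ((p + 2 : ℕ) : ℝ) := by push_cast; linarith
    have := Nat.cast_lt.1 this
    lia
  obtain ⟨v, q, hvc, hqd, hvu, hv⟩ := exists_hasFracTaylor_comp_affine hk hm hα0 hα2 hh hu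
  set Q := P.comp (Polynomial.C (a + h) - Polynomial.C h * Polynomial.X) with hQ
  have hQe : ∀ y, Q.eval y = P.eval (a + h - h * y) := eval_comp_affine P _ _
  have hscale : ∀ f : ℝ → ℝ, h * ∫ y in (0 : ℝ)..1, f (a + h - h * y) = ∫ x in a..(a + h), f x := by
    intro f
    rw [integral_comp_affine hh, mul_zero, sub_zero]
  have horthQ : ∀ n < p, ∫ y in (0 : ℝ)..1, (Q.eval y - v y) * (leg n).eval y = 0 := by
    intro n hn
    set V := (leg n).comp (Polynomial.C ((a + h) / h) - Polynomial.C (1 / h) * Polynomial.X)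
    have hV : ∀ y, V.eval (a + h - h * y) = (leg n).eval y := by
      intro y
      rw [eval_comp_affine]
      congr 1
      field_simp
      ring
    have h1 := hscale fun x => (P.eval x - u x) * V.eval x
    rw [horth V ((natDegree_comp_affine_le _ _ _).trans_lt (by rwa [natDegree_leg]))] at h1
    refine (intervalIntegral.integral_congr fun y hy => ?_).trans
      ((mul_eq_zero_iff_left hh.ne').1 h1)
    rw [uIcc_of_le zero_le_one] at hy
    simp only [hV, hQe, hvu y hy]
  have hmain := hrad p hkp v q _ _ hvc
    ((intervalIntegrable_comp_affine hh (hu.2.2.2.2.1 m le_rfl)).const_mul _) hqd hv Q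
    ((natDegree_comp_affine_le _ _ _).trans hP) horthQ (by
      rw [hQe, hvu 0 (left_mem_Icc.2 zero_le_one), mul_zero, sub_zero, hPb])
  have hnorm : ∫ x in a..(a + h), (u x - P.eval x) ^ 2 = h * normSq fun y => v y - Q.eval y := by
    rw [← hscale, normSq]
    congr 1
    refine intervalIntegral.integral_congr fun y hy => ?_
    rw [uIcc_of_le zero_le_one] at hy
    simp only [hQe, hvu y hy]
  rw [hnorm, Real.sqrt_mul hh.le, Real.rpow_add hh, ← Real.sqrt_eq_rpow]
  calc √h * √(normSq fun y => v y - Q.eval y)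
      ≤ √h * (C * (p : ℝ) ^ (-(min (2 * α + 1) (α + (m : ℝ) - 1 / 2))) *
          (K * h ^ α * UsemiLOn k m α a (a + h) u L)) := by
        refine mul_le_mul_of_nonneg_left (hmain.trans ?_) (Real.sqrt_nonneg h)
        exact mul_le_mul_of_nonneg_left (hbound a h hh h2 L _) (by positivity)
    _ = _ := by ring
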